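/- There are constants b₀ and b₄, …, b₈ > 0 (depending only on λ and Λ as appropriate) such that for every λ > 0, every Λ < ∞, and every finite connected transitive graph 𝔾 satisfying the triangle condition ∇_{p_c}(x,y) ≤ δ_{x,y} + a₀ with a₀ ≤ b₀ and λV^{1/3} ≥ b₀^{-1}, the following holds for p = p_c + Ω^{-1}ε with |ε| ≤ ΛV^{-1/3}: (i) b₄V^{2/3} ≤ 𝔼_p|C_max| ≤ b₅V^{2/3}; (ii) for every ω ≥ 1, ℙ_p(ω^{-1}V^{2/3} ≤ |C_max| ≤ ωV^{2/3}) ≥ 1 − b₆/ω; and (iii) b₇V^{1/3} ≤ χ(p) ≤ b₈V^{1/3}. -/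

import Mathlib

noncomputable section
open Classical

namespace Percolation

variable {V : Type*} [Fintype V] [DecidableEq V]

/-- A percolation configuration: an assignment of occupied (`true`) or
vacant (`false`) to each bond of the graph. -/
def Config (G : SimpleGraph V) : Type _ := G.edgeSet → Bool

noncomputable instance (G : SimpleGraph V) : Fintype G.edgeSet :=
  Fintype.ofFinite _

noncomputable instance (G : SimpleGraph V) : Fintype (Config G) :=
  inferInstanceAs (Fintype (G.edgeSet → Bool))

/-- The probability weight of a configuration under the product Bernoulli
measure with parameter `p`. -/
def weight (G : SimpleGraph V) (p : ℝ) (ω : Config G) : ℝ :=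
  ∏ e : G.edgeSet, if ω e then p else 1 - p

/-- The probability of an event under the percolation measure `ℙ_p`. -/
def prob (G : SimpleGraph V) (p : ℝ) (A : Config G → Prop) : ℝ :=
  ∑ ω : Config G, if A ω then weight G p ω else 0

/-- The expectation of a random variable under the percolation measure `ℙ_p`. -/
def expect (G : SimpleGraph V) (p : ℝ) (f : Config G → ℝ) : ℝ :=
  ∑ ω : Config G, weight G p ω * f ω

/-- The subgraph consisting of the occupied bonds of a configuration. -/
def occupied (G : SimpleGraph V) (ω : Config G) : SimpleGraph V :=
  SimpleGraph.fromEdgeSet {e | ∃ h : e ∈ G.edgeSet, ω ⟨e, h⟩ = true}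

/-- The cluster `C(x)` of the vertex `x`: all vertices joined to `x` by a path
of occupied bonds (including `x` itself). -/
def cluster (G : SimpleGraph V) (ω : Config G) (x : V) : Finset V :=
  Finset.univ.filter fun y => (occupied G ω).Reachable x y

/-- The susceptibility `χ(p)`: the expected size of the cluster of `x₀`. -/
def chi (G : SimpleGraph V) (x₀ : V) (p : ℝ) : ℝ :=
  expect G p fun ω => ((cluster G ω x₀).card : ℝ)

/-- The two-point function `τ_p(x,y) = ℙ_p(x ↔ y)`. -/
def tau (G : SimpleGraph V) (p : ℝ) (x y : V) : ℝ :=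
  prob G p fun ω => (occupied G ω).Reachable x y

/-- The triangle diagram `∇_p(x,y)`. -/
def triangle (G : SimpleGraph V) (p : ℝ) (x y : V) : ℝ :=
  ∑ u : V, ∑ v : V, tau G p x u * tau G p u v * tau G p v y

/-- The Kronecker delta `δ_{x,y}`. -/
def kron (x y : V) : ℝ := if x = y then 1 else 0

/-- `∇̄_p`: the maximum of the triangle diagram over bonds `{x,y} ∈ 𝔹`. -/
def nablaBar (G : SimpleGraph V) (p : ℝ) : ℝ :=
  sSup {t : ℝ | ∃ x y : V, G.Adj x y ∧ t = triangle G p x y}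

/-- A graph is (vertex-)transitive if any vertex can be mapped to any other
by a graph automorphism. -/
def IsTransitive (G : SimpleGraph V) : Prop :=
  ∀ x y : V, ∃ φ : G ≃g G, φ x = y

/-- The size `|C_max|` of the largest cluster. -/
def maxCluster (G : SimpleGraph V) (ω : Config G) : ℕ :=
  Finset.univ.sup fun x => (cluster G ω x).card

/-- The cluster size distribution `P_{≥k}(p) = ℙ_p(|C(x₀)| ≥ k)`. -/
def Pgeq (G : SimpleGraph V) (x₀ : V) (p : ℝ) (k : ℝ) : ℝ :=
  prob G p fun ω => k ≤ ((cluster G ω x₀).card : ℝ)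

/-- The magnetization `M(p,γ)`. -/
def magnetization (G : SimpleGraph V) (x₀ : V) (p γ : ℝ) : ℝ :=
  ∑ k ∈ Finset.Icc 1 (Fintype.card V),
    (1 - (1 - γ) ^ k) * prob G p fun ω => (cluster G ω x₀).card = k

/-- `Z_{≥s}`: the number of vertices lying in clusters of size at least `s`. -/
def Zgeq (G : SimpleGraph V) (s : ℝ) (ω : Config G) : ℝ :=
  ∑ x : V, if s ≤ ((cluster G ω x).card : ℝ) then (1 : ℝ) else 0

/-- The variance of a random variable under `ℙ_p`. -/
def variance (G : SimpleGraph V) (p : ℝ) (f : Config G → ℝ) : ℝ :=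
  expect G p (fun ω => f ω ^ 2) - (expect G p f) ^ 2

/-- The restricted susceptibility `χ_{≥s}(p) = 𝔼_p[|C(x₀)| I[|C(x₀)| ≥ s]]`. -/
def chiGeq (G : SimpleGraph V) (x₀ : V) (p : ℝ) (s : ℝ) : ℝ :=
  expect G p fun ω =>
    if s ≤ ((cluster G ω x₀).card : ℝ) then ((cluster G ω x₀).card : ℝ) else 0

/-- The restricted susceptibility `χ_{<s}(p) = 𝔼_p[|C(x₀)| I[|C(x₀)| < s]]`. -/
def chiLt (G : SimpleGraph V) (x₀ : V) (p : ℝ) (s : ℝ) : ℝ :=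
  expect G p fun ω =>
    if ((cluster G ω x₀).card : ℝ) < s then ((cluster G ω x₀).card : ℝ) else 0

end Percolation


set_option linter.unusedSectionVars false

namespace PW

section generic
variable {E : Type*} [Fintype E]

/-- product Bernoulli weight -/
def wt (p : ℝ) (ω : E → Bool) : ℝ := ∏ e, if ω e then p else 1 - p

/-- expectation under the product Bernoulli weight -/
def Ex (p : ℝ) (f : (E → Bool) → ℝ) : ℝ := ∑ ω : E → Bool, wt p ω * f ω

/-- indicator -/
def ind (P : Prop) : ℝ := if P then 1 else 0

lemma ind_nonneg (P : Prop) : 0 ≤ ind P := by unfold ind; split_ifs <;> norm_num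
lemma ind_le_one (P : Prop) : ind P ≤ 1 := by unfold ind; split_ifs <;> norm_num
lemma ind_mono {P Q : Prop} (h : P → Q) : ind P ≤ ind Q := by
  by_cases hP : P
  · simp [ind, hP, h hP]
  · simp only [ind, hP, if_false]; split_ifs <;> norm_num
lemma ind_true {P : Prop} (h : P) : ind P = 1 := by simp [ind, h]
lemma ind_false {P : Prop} (h : ¬ P) : ind P = 0 := by simp [ind, h]
lemma ind_congr {P Q : Prop} (h : P ↔ Q) : ind P = ind Q := by simp [ind, h]

lemma wt_nonneg {p : ℝ} (h0 : 0 ≤ p) (h1 : p ≤ 1) (ω : E → Bool) : 0 ≤ wt p ω :=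
  Finset.prod_nonneg fun e _ => by split_ifs <;> linarith

lemma Ex_add (p : ℝ) (f g : (E → Bool) → ℝ) :
    Ex p (fun ω => f ω + g ω) = Ex p f + Ex p g := by
  simp [Ex, mul_add, Finset.sum_add_distrib]

lemma Ex_sub (p : ℝ) (f g : (E → Bool) → ℝ) :
    Ex p (fun ω => f ω - g ω) = Ex p f - Ex p g := by
  simp [Ex, mul_sub, Finset.sum_sub_distrib]

lemma Ex_const_mul (p c : ℝ) (f : (E → Bool) → ℝ) :
    Ex p (fun ω => c * f ω) = c * Ex p f := by
  simp only [Ex, Finset.mul_sum]; exact Finset.sum_congr rfl fun _ _ => by ring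

lemma Ex_mul_const (p c : ℝ) (f : (E → Bool) → ℝ) :
    Ex p (fun ω => f ω * c) = Ex p f * c := by
  simp only [Ex, Finset.sum_mul]; exact Finset.sum_congr rfl fun _ _ => by ring

lemma Ex_sum {ι : Type*} (s : Finset ι) (p : ℝ) (f : ι → (E → Bool) → ℝ) :
    Ex p (fun ω => ∑ i ∈ s, f i ω) = ∑ i ∈ s, Ex p (f i) := by
  simp only [Ex, Finset.mul_sum]; exact Finset.sum_comm

lemma Ex_mono {p : ℝ} (h0 : 0 ≤ p) (h1 : p ≤ 1) {f g : (E → Bool) → ℝ} (h : ∀ ω, f ω ≤ g ω) :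
    Ex p f ≤ Ex p g :=
  Finset.sum_le_sum fun ω _ => mul_le_mul_of_nonneg_left (h ω) (wt_nonneg h0 h1 ω)

lemma Ex_nonneg {p : ℝ} (h0 : 0 ≤ p) (h1 : p ≤ 1) {f : (E → Bool) → ℝ} (h : ∀ ω, 0 ≤ f ω) :
    0 ≤ Ex p f :=
  Finset.sum_nonneg fun ω _ => mul_nonneg (wt_nonneg h0 h1 ω) (h ω)

lemma Ex_one (p : ℝ) : Ex p (fun _ : E → Bool => (1 : ℝ)) = 1 := by
  have h := Finset.prod_univ_sum (fun _ : E => (Finset.univ : Finset Bool))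
    (fun _ b => if b then p else 1 - p)
  simp only [Fintype.piFinset_univ] at h
  simp only [Ex, wt, mul_one]
  rw [← h]
  simp

lemma Ex_const (p c : ℝ) : Ex p (fun _ : E → Bool => c) = c := by
  have := Ex_const_mul p c (fun _ : E → Bool => (1 : ℝ))
  simpa [Ex_one] using this

lemma Ex_cauchy {p : ℝ} (h0 : 0 ≤ p) (h1 : p ≤ 1) (f g : (E → Bool) → ℝ) :
    (Ex p (fun ω => f ω * g ω)) ^ 2 ≤ Ex p (fun ω => f ω ^ 2) * Ex p (fun ω => g ω ^ 2) := by
  have h := Finset.sum_mul_sq_le_sq_mul_sq (Finset.univ : Finset (E → Bool))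
    (fun ω => √(wt p ω) * f ω) (fun ω => √(wt p ω) * g ω)
  have hs : ∀ ω : E → Bool, √(wt p ω) * √(wt p ω) = wt p ω := fun ω =>
    Real.mul_self_sqrt (wt_nonneg h0 h1 ω)
  have e1 : ∀ ω : E → Bool, √(wt p ω) * f ω * (√(wt p ω) * g ω) = wt p ω * (f ω * g ω) := by
    intro ω; nth_rewrite 3 [← hs ω]; ring
  have e2 : ∀ (f : (E → Bool) → ℝ) (ω : E → Bool), (√(wt p ω) * f ω) ^ 2 = wt p ω * (f ω) ^ 2 := by
    intro f ω; nth_rewrite 2 [← hs ω]; ring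
  simp only [e1, e2] at h
  exact h

/-- mix two configurations -/
def mix (S : Set E) (ω ω' : E → Bool) : E → Bool := fun e => if e ∈ S then ω e else ω' e

lemma wt_mix (p : ℝ) (S : Set E) (ω ω' : E → Bool) :
    wt p (mix S ω ω') * wt p (mix S ω' ω) = wt p ω * wt p ω' := by
  simp only [wt, ← Finset.prod_mul_distrib]
  refine Finset.prod_congr rfl fun e _ => ?_
  by_cases h : e ∈ S
  · simp [mix, h]
  · simp [mix, h, mul_comm]

lemma Ex_indep (p : ℝ) (S : Set E) (f g : (E → Bool) → ℝ)
    (hf : ∀ ω ω', (∀ e ∈ S, ω e = ω' e) → f ω = f ω')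
    (hg : ∀ ω ω', (∀ e ∉ S, ω e = ω' e) → g ω = g ω') :
    Ex p (fun ω => f ω * g ω) = Ex p f * Ex p g := by
  have h1 : Ex p f * Ex p g = ∑ x : (E → Bool) × (E → Bool), wt p x.1 * wt p x.2 * (f x.1 * g x.2) := by
    rw [Fintype.sum_prod_type]
    simp only [Ex, Finset.sum_mul_sum]
    exact Finset.sum_congr rfl fun _ _ => Finset.sum_congr rfl fun _ _ => by ring
  have h2 : Ex p (fun ω => f ω * g ω) = ∑ x : (E → Bool) × (E → Bool), wt p x.1 * wt p x.2 * (f x.1 * g x.1) := by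
    rw [Fintype.sum_prod_type]
    have : ∀ x : E → Bool, ∑ y : E → Bool, wt p x * wt p y * (f x * g x) = wt p x * (f x * g x) := by
      intro x
      have h := Ex_one (E := E) p
      simp only [Ex, mul_one] at h
      rw [← Finset.sum_mul, ← Finset.mul_sum, h]; ring
    simp only [this, Ex]
  rw [h1, h2]
  let Φ : (E → Bool) × (E → Bool) ≃ (E → Bool) × (E → Bool) :=
    { toFun := fun x => (mix S x.1 x.2, mix S x.2 x.1)
      invFun := fun x => (mix S x.1 x.2, mix S x.2 x.1)
      left_inv := by
        rintro ⟨a, b⟩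
        refine Prod.ext ?_ ?_ <;> funext e <;> by_cases h : e ∈ S <;> simp [mix, h]
      right_inv := by
        rintro ⟨a, b⟩
        refine Prod.ext ?_ ?_ <;> funext e <;> by_cases h : e ∈ S <;> simp [mix, h] }
  symm
  refine Fintype.sum_equiv Φ _ _ ?_
  rintro ⟨a, b⟩
  show wt p a * wt p b * (f a * g b) =
    wt p (mix S a b) * wt p (mix S b a) * (f (mix S a b) * g (mix S a b))
  rw [wt_mix]
  congr 2
  · exact hf _ _ fun e he => by simp [mix, he]
  · exact hg _ _ fun e he => by simp [mix, he]

/-- set a coordinate -/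
abbrev upd (ω : E → Bool) (e : E) (b : Bool) : E → Bool := Function.update ω e b

lemma Ex_coord (p : ℝ) (e : E) (f : (E → Bool) → ℝ) :
    Ex p f = Ex p (fun ω => p * f (upd ω e true) + (1 - p) * f (upd ω e false)) := by
  have hT : Ex p (fun ω : E → Bool => ind (ω e = true)) = p := by
    have h := Finset.prod_univ_sum (fun _ : E => (Finset.univ : Finset Bool))
      (fun e' b => (if b then p else 1 - p) * if e' = e then ind (b = true) else 1)
    simp only [Fintype.piFinset_univ, Finset.prod_mul_distrib] at h
    have h2 : ∀ ω : E → Bool, (∏ e' : E, if e' = e then ind (ω e' = true) else 1) = ind (ω e = true) := by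
      intro ω; rw [Finset.prod_ite_eq']; simp
    simp only [h2] at h
    simp only [Ex, wt]
    rw [← h]
    rw [Finset.prod_eq_single e]
    · simp [ind]
    · intro b _ hb; simp [hb]
    · simp
  have hF : Ex p (fun ω : E → Bool => ind (ω e = false)) = 1 - p := by
    have : ∀ ω : E → Bool, ind (ω e = false) = 1 - ind (ω e = true) := by
      intro ω; cases h : ω e <;> simp [ind]
    simp only [this]
    rw [Ex_sub, hT, Ex_one]
  have h1 : ∀ ω, f ω = ind (ω e = true) * f (upd ω e true) + ind (ω e = false) * f (upd ω e false) := by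
    intro ω
    cases h : ω e
    · have : upd ω e false = ω := by rw [← h]; simp [upd]
      simp [ind, this]
    · have : upd ω e true = ω := by rw [← h]; simp [upd]
      simp [ind, this]
  have h2 : ∀ b, Ex p (fun ω => ind (ω e = b) * f (upd ω e b))
      = Ex p (fun ω : E → Bool => ind (ω e = b)) * Ex p (fun ω => f (upd ω e b)) := by
    intro b
    refine Ex_indep p {e} _ _ ?_ ?_
    · intro ω ω' h; rw [h e rfl]
    · intro ω ω' h
      congr 1
      funext e'
      by_cases h' : e' = e
      · subst h'; simp [upd]
      · simp [upd, h', h e' h']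
  conv_lhs => rw [show f = fun ω => ind (ω e = true) * f (upd ω e true) + ind (ω e = false) * f (upd ω e false) from funext h1]
  rw [Ex_add, h2, h2, hT, hF, Ex_add, Ex_const_mul, Ex_const_mul]

/-- discrete derivative -/
def dif (f : (E → Bool) → ℝ) (e : E) (ω : E → Bool) : ℝ := f (upd ω e true) - f (upd ω e false)

lemma hasDerivAt_Ex (f : (E → Bool) → ℝ) (p : ℝ) :
    HasDerivAt (fun p => Ex p f) (∑ e, Ex p (dif f e)) p := by
  -- derivative of a single factor
  have hw : ∀ ω : E → Bool, HasDerivAt (fun p => wt p ω)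
      (∑ e, (∏ e' ∈ Finset.univ.erase e, if ω e' then p else 1 - p) * (if ω e then (1:ℝ) else -1)) p := by
    intro ω
    have h := HasDerivAt.fun_finsetProd (u := (Finset.univ : Finset E))
      (f := fun e (p : ℝ) => if ω e then p else 1 - p)
      (f' := fun e => if ω e then (1:ℝ) else -1) (x := p) (by
        intro e _
        cases h : ω e
        · simpa using (hasDerivAt_id p).const_sub 1
        · simpa using (hasDerivAt_id' p))
    simpa [wt] using h
  have hsum : HasDerivAt (fun p => Ex p f)
      (∑ ω : E → Bool, (∑ e, (∏ e' ∈ Finset.univ.erase e, if ω e' then p else 1 - p) * (if ω e then (1:ℝ) else -1)) * f ω) p := by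
    unfold Ex
    exact HasDerivAt.fun_sum fun ω _ => (hw ω).mul_const _
  convert hsum using 1
  simp only [Finset.sum_mul]
  rw [Finset.sum_comm]
  refine Finset.sum_congr rfl fun e _ => ?_
  -- for fixed e
  set W : (E → Bool) → ℝ := fun ω => ∏ e' ∈ Finset.univ.erase e, if ω e' then p else 1 - p with hW
  have hWu : ∀ ω b, W (upd ω e b) = W ω := by
    intro ω b
    refine Finset.prod_congr rfl fun e' he' => ?_
    simp [upd, Finset.ne_of_mem_erase he']
  have hwt : ∀ ω, wt p ω = (if ω e then p else 1 - p) * W ω := by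
    intro ω
    rw [wt, hW, Finset.mul_prod_erase Finset.univ (fun e' => if ω e' then p else 1 - p) (Finset.mem_univ e)]
  -- involution
  let τ : (E → Bool) ≃ (E → Bool) :=
    { toFun := fun ω => upd ω e (!ω e)
      invFun := fun ω => upd ω e (!ω e)
      left_inv := by intro ω; simp [upd]
      right_inv := by intro ω; simp [upd] }
  have key : ∀ g : (E → Bool) → ℝ, (∀ ω b, g (upd ω e b) = g ω) →
      ∑ ω : E → Bool, wt p ω * g ω = ∑ ω : E → Bool, W ω * g ω * (1/2) := by
    intro g hg
    have h2 : ∑ ω : E → Bool, wt p ω * g ω = ∑ ω : E → Bool, wt p (τ ω) * g ω := by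
      rw [← Equiv.sum_comp τ]
      refine Finset.sum_congr rfl fun ω _ => ?_
      rw [show g (τ ω) = g ω from hg _ _]
    have h3 : ∀ ω, wt p (τ ω) = (if ω e then 1 - p else p) * W ω := by
      intro ω
      rw [hwt]; show _ * W (upd ω e _) = _
      rw [hWu]
      cases h : ω e <;> simp [τ, h, upd]
    have : (2:ℝ) * ∑ ω : E → Bool, wt p ω * g ω = ∑ ω : E → Bool, W ω * g ω := by
      rw [two_mul]; nth_rewrite 2 [h2]
      rw [← Finset.sum_add_distrib]
      refine Finset.sum_congr rfl fun ω _ => ?_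
      rw [h3, hwt]; cases h : ω e <;> simp <;> ring
    rw [← Finset.sum_mul, ← this]; ring
  have hd : ∀ ω b, dif f e (upd ω e b) = dif f e ω := by intro ω b; simp [dif, upd]
  rw [Ex, key _ hd, ← Finset.sum_mul]
  have h4 : ∑ ω : E → Bool, W ω * (if ω e then (1:ℝ) else -1) * f ω
      = ∑ ω : E → Bool, W ω * (if ω e then (-1:ℝ) else 1) * f (τ ω) := by
    rw [← Equiv.sum_comp τ]
    refine Finset.sum_congr rfl fun ω _ => ?_
    rw [show W (τ ω) = W ω from hWu _ _]
    cases h : ω e <;> simp [τ, h, upd]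
  have h5 : (2:ℝ) * ∑ ω : E → Bool, W ω * (if ω e then (1:ℝ) else -1) * f ω
      = ∑ ω : E → Bool, W ω * dif f e ω := by
    rw [two_mul]; nth_rewrite 2 [h4]
    rw [← Finset.sum_add_distrib]
    refine Finset.sum_congr rfl fun ω _ => ?_
    have hs : ω = upd ω e (ω e) := by simp [upd]
    cases h : ω e
    · have h' : upd ω e false = ω := by rw [← h]; simp [upd]
      simp [dif, h', τ, h]; ring
    · have h' : upd ω e true = ω := by rw [← h]; simp [upd]
      simp [dif, h', τ, h]; ring
  rw [← h5]; ring

lemma Ex_differentiable (f : (E → Bool) → ℝ) : Differentiable ℝ (fun p => Ex p f) :=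
  fun p => (hasDerivAt_Ex f p).differentiableAt

lemma Ex_monotone_p {f : (E → Bool) → ℝ} (hf : Monotone f) {p q : ℝ} (h0 : 0 ≤ p) (hpq : p ≤ q)
    (h1 : q ≤ 1) : Ex p f ≤ Ex q f := by
  have hm : MonotoneOn (fun p => Ex p f) (Set.Icc (0:ℝ) 1) := by
    refine monotoneOn_of_deriv_nonneg (convex_Icc 0 1) (Ex_differentiable f).continuous.continuousOn
      (Ex_differentiable f).differentiableOn ?_
    intro x hx
    rw [interior_Icc] at hx
    rw [(hasDerivAt_Ex f x).deriv]
    refine Finset.sum_nonneg fun e _ => Ex_nonneg hx.1.le hx.2.le fun ω => ?_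
    refine sub_nonneg.2 (hf ?_)
    intro e'
    by_cases h : e' = e
    · subst h; simp [upd]
    · simp [upd, h]
  exact hm ⟨h0, hpq.trans h1⟩ ⟨h0.trans hpq, h1⟩ hpq

/-- restriction of a configuration to a set of bonds -/
def restr (ω : E → Bool) (S : Set E) : E → Bool := fun e => ω e && decide (e ∈ S)

lemma restr_le (ω : E → Bool) (S : Set E) : restr ω S ≤ ω := by
  intro e; simp only [restr]; cases ω e <;> simp

lemma restr_mono {ω ω' : E → Bool} (h : ω ≤ ω') {S T : Set E} (hST : S ⊆ T) : restr ω S ≤ restr ω' T := by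
  intro e
  have := h e
  by_cases hs : e ∈ S
  · simpa [restr, hs, hST hs] using this
  · simp [restr, hs]

/-- disjoint occurrence for increasing events -/
def DO (X Y : (E → Bool) → Prop) (ω : E → Bool) : Prop :=
  ∃ S : Set E, X (restr ω S) ∧ Y (restr ω Sᶜ)

/-- increasing event -/
def Inc (X : (E → Bool) → Prop) : Prop := ∀ ω ω', ω ≤ ω' → X ω → X ω'

lemma Inc.ind_mono {X : (E → Bool) → Prop} (h : Inc X) : Monotone (fun ω => ind (X ω)) :=
  fun ω ω' hw => PW.ind_mono (h ω ω' hw)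

lemma DO_inc {X Y : (E → Bool) → Prop} (hX : Inc X) (hY : Inc Y) : Inc (DO X Y) := by
  rintro ω ω' h ⟨S, h1, h2⟩
  exact ⟨S, hX _ _ (restr_mono h subset_rfl) h1, hY _ _ (restr_mono h subset_rfl) h2⟩

/-- hybrid event in the proof of BK -/
def hyb (X Y : (E → Bool) → Prop) (U : Finset E) (ω ω' : E → Bool) : Prop :=
  ∃ S : Set E, X (restr ω S) ∧ Y (fun e => if e ∈ U then ω' e else restr ω Sᶜ e)

lemma hyb_step {X Y : (E → Bool) → Prop} (hX : Inc X) (hY : Inc Y) {p : ℝ} (h0 : 0 ≤ p) (h1 : p ≤ 1)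
    (U : Finset E) (e : E) (he : e ∉ U) :
    Ex p (fun ω => Ex p (fun ω' => ind (hyb X Y U ω ω'))) ≤
    Ex p (fun ω => Ex p (fun ω' => ind (hyb X Y (insert e U) ω ω'))) := by
  have hR : ∀ ω, Ex p (fun ω' => ind (hyb X Y (insert e U) ω ω'))
      = Ex p (fun ω' => p * ind (hyb X Y (insert e U) ω (upd ω' e true)) +
        (1 - p) * ind (hyb X Y (insert e U) ω (upd ω' e false))) := fun ω => Ex_coord p e _
  rw [Ex_coord p e, Ex_coord p e (fun ω => Ex p (fun ω' => ind (hyb X Y (insert e U) ω ω')))]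
  refine Ex_mono h0 h1 fun ω => ?_
  rw [hR, hR, ← Ex_const_mul, ← Ex_const_mul, ← Ex_const_mul, ← Ex_const_mul, ← Ex_add, ← Ex_add]
  refine Ex_mono h0 h1 fun ω' => ?_
  set L1 := hyb X Y U (upd ω e true) ω' with hL1
  set L0 := hyb X Y U (upd ω e false) ω' with hL0
  have hle : ∀ b, upd ω e false ≤ upd ω e b := by
    intro b e'; by_cases h : e' = e
    · subst h; simp [upd]
    · simp [upd, h]
  have c0 : L0 → ∀ i j, hyb X Y (insert e U) (upd ω e i) (upd ω' e j) := by
    rintro ⟨S, hSx, hSy⟩ i j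
    refine ⟨S, hX _ _ (restr_mono (hle i) subset_rfl) hSx, hY _ _ ?_ hSy⟩
    intro e'
    by_cases h : e' = e
    · subst h; simp [he, restr, upd]
    · by_cases hU : e' ∈ U
      · simp [hU, upd, h]
      · simp [hU, upd, h, restr]
  have c1 : L1 → (∀ j, hyb X Y (insert e U) (upd ω e true) (upd ω' e j)) ∨
      (∀ i, hyb X Y (insert e U) (upd ω e i) (upd ω' e true)) := by
    rintro ⟨S, hSx, hSy⟩
    by_cases heS : e ∈ S
    · left; intro j
      refine ⟨S, hSx, hY _ _ ?_ hSy⟩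
      intro e'
      by_cases h : e' = e
      · subst h; simp [he, restr, heS]
      · by_cases hU : e' ∈ U
        · simp [hU, upd, h]
        · simp [hU, upd, h, restr]
    · right; intro i
      refine ⟨S, hX _ _ ?_ hSx, hY _ _ ?_ hSy⟩
      · intro e'
        by_cases h : e' = e
        · subst h; simp [restr, heS]
        · simp [restr, upd, h]
      · intro e'
        by_cases h : e' = e
        · subst h; simp [upd]
        · by_cases hU : e' ∈ U
          · simp [hU, upd, h]
          · simp [hU, upd, h, restr]
  have hq : 0 ≤ 1 - p := by linarith
  have n11 := ind_nonneg (hyb X Y (insert e U) (upd ω e true) (upd ω' e true))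
  have n10 := ind_nonneg (hyb X Y (insert e U) (upd ω e true) (upd ω' e false))
  have n01 := ind_nonneg (hyb X Y (insert e U) (upd ω e false) (upd ω' e true))
  have n00 := ind_nonneg (hyb X Y (insert e U) (upd ω e false) (upd ω' e false))
  have hpp := mul_nonneg h0 h0
  have hpq := mul_nonneg h0 hq
  have hqq := mul_nonneg hq hq
  by_cases k0 : L0
  · rw [ind_true (c0 k0 true true), ind_true (c0 k0 true false), ind_true (c0 k0 false true),
      ind_true (c0 k0 false false)]
    nlinarith [mul_le_mul_of_nonneg_left (ind_le_one L1) h0, mul_le_mul_of_nonneg_left (ind_le_one L0) hq]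
  · rw [ind_false k0]
    by_cases k1 : L1
    · rw [ind_true k1]
      rcases c1 k1 with h | h
      · rw [ind_true (h true), ind_true (h false)]
        nlinarith [mul_nonneg hpq n01, mul_nonneg hqq n00]
      · rw [ind_true (h true), ind_true (h false)]
        nlinarith [mul_nonneg hpq n10, mul_nonneg hqq n00]
    · rw [ind_false k1]
      nlinarith [mul_nonneg hpp n11, mul_nonneg hpq n10, mul_nonneg hpq n01, mul_nonneg hqq n00]

theorem BK {X Y : (E → Bool) → Prop} (hX : Inc X) (hY : Inc Y) {p : ℝ} (h0 : 0 ≤ p) (h1 : p ≤ 1) :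
    Ex p (fun ω => ind (DO X Y ω)) ≤ Ex p (fun ω => ind (X ω)) * Ex p (fun ω => ind (Y ω)) := by
  have h : ∀ U : Finset E, Ex p (fun ω => ind (DO X Y ω)) ≤
      Ex p (fun ω => Ex p (fun ω' => ind (hyb X Y U ω ω'))) := by
    intro U
    induction U using Finset.induction_on with
    | empty =>
      refine Ex_mono h0 h1 fun ω => ?_
      have : ∀ ω', hyb X Y ∅ ω ω' ↔ DO X Y ω := by
        intro ω'; simp [hyb, DO]
      simp only [ind_congr (this _), Ex_const, le_refl]
    | insert e U he ih => exact ih.trans (hyb_step hX hY h0 h1 U e he)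
  refine (h Finset.univ).trans ?_
  have h2 : Ex p (fun ω => ind (X ω)) * Ex p (fun ω => ind (Y ω)) =
      Ex p (fun ω => Ex p (fun ω' => ind (X ω) * ind (Y ω'))) := by
    simp only [Ex_const_mul, Ex_mul_const]
  rw [h2]
  refine Ex_mono h0 h1 fun ω => Ex_mono h0 h1 fun ω' => ?_
  by_cases hh : hyb X Y Finset.univ ω ω'
  · obtain ⟨S, hSx, hSy⟩ := hh
    have a : X ω := hX _ _ (restr_le _ _) hSx
    have b : Y ω' := by simpa using hSy
    rw [ind_true a, ind_true b]; simpa using ind_le_one _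
  · rw [ind_false hh]; exact mul_nonneg (ind_nonneg _) (ind_nonneg _)

end generic
end PW

set_option linter.unusedSectionVars false

namespace PW
open Percolation

section graph
variable {V : Type} [Fintype V] {G : SimpleGraph V}

def ceq (G : SimpleGraph V) : Config G ≃ (G.edgeSet → Bool) := ⟨fun x => x, fun x => x, fun _ => rfl, fun _ => rfl⟩

lemma expect_eq (p : ℝ) (f : (G.edgeSet → Bool) → ℝ) : expect G p f = Ex p f := by
  unfold expect Ex
  convert Fintype.sum_equiv (M := ℝ) (ceq G)
    (fun ω => weight G p ω * f ω) (fun ω => wt p ω * f ω) (fun ω => rfl)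

lemma ite_ind (Q : Prop) (c : ℝ) : (if Q then c else 0) = c * ind Q := by
  by_cases h : Q
  · rw [ind_true h, if_pos h, mul_one]
  · rw [ind_false h, if_neg h, mul_zero]

lemma prob_eq (p : ℝ) (A : (G.edgeSet → Bool) → Prop) : prob G p A = Ex p (fun ω => ind (A ω)) := by
  unfold prob Ex
  convert Fintype.sum_equiv (M := ℝ) (ceq G)
    (fun ω => if A ω then weight G p ω else 0) (fun ω => wt p ω * ind (A ω)) (fun ω => ite_ind (A ω) (weight G p ω))

/-- cluster -/
abbrev Cl (ω : G.edgeSet → Bool) (x : V) : Finset V := cluster G ω x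

/-- open adjacency -/
abbrev OA (ω : G.edgeSet → Bool) (a b : V) : Prop := (occupied G ω).Adj a b

lemma occ_adj (ω : G.edgeSet → Bool) (a b : V) :
    OA ω a b ↔ ∃ h : G.Adj a b, ω ⟨s(a,b), h⟩ = true := by
  simp only [OA, occupied, SimpleGraph.fromEdgeSet_adj, Set.mem_ofPred_eq]
  constructor
  · rintro ⟨⟨h, h'⟩, _⟩; exact ⟨h, h'⟩
  · rintro ⟨h, h'⟩; exact ⟨⟨h, h'⟩, h.ne⟩

lemma mem_cl {ω : G.edgeSet → Bool} {x y : V} : y ∈ Cl ω x ↔ (occupied G ω).Reachable x y := by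
  simp [Cl, cluster]

lemma self_mem_cl (ω : G.edgeSet → Bool) (x : V) : x ∈ Cl ω x := mem_cl.2 (SimpleGraph.Reachable.refl _)

lemma mem_cl_symm {ω : G.edgeSet → Bool} {x y : V} (h : y ∈ Cl ω x) : x ∈ Cl ω y :=
  mem_cl.2 (mem_cl.1 h).symm

lemma mem_cl_comm {ω : G.edgeSet → Bool} {x y : V} : y ∈ Cl ω x ↔ x ∈ Cl ω y :=
  ⟨mem_cl_symm, mem_cl_symm⟩

lemma mem_cl_trans {ω : G.edgeSet → Bool} {x y z : V} (h : y ∈ Cl ω x) (h' : z ∈ Cl ω y) : z ∈ Cl ω x :=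
  mem_cl.2 ((mem_cl.1 h).trans (mem_cl.1 h'))

lemma cl_eq {ω : G.edgeSet → Bool} {x y : V} (h : y ∈ Cl ω x) : Cl ω y = Cl ω x := by
  ext z; exact ⟨mem_cl_trans h, mem_cl_trans (mem_cl_symm h)⟩

lemma cl_disj {ω : G.edgeSet → Bool} {x y : V} (h : y ∉ Cl ω x) : Disjoint (Cl ω x) (Cl ω y) := by
  rw [Finset.disjoint_left]
  intro z h1 h2
  exact h (mem_cl_trans h1 (mem_cl_symm h2))

lemma cl_step {ω : G.edgeSet → Bool} {x a b : V} (h : a ∈ Cl ω x) (hab : OA ω a b) : b ∈ Cl ω x :=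
  mem_cl.2 ((mem_cl.1 h).trans hab.reachable)

lemma reach_closed {H : SimpleGraph V} {A : Set V} {x y : V} (hx : x ∈ A)
    (hc : ∀ a ∈ A, ∀ b, H.Adj a b → b ∈ A) (h : H.Reachable x y) : y ∈ A := by
  obtain ⟨w⟩ := h
  induction w with
  | nil => exact hx
  | cons hab _ ih => exact ih (hc _ hx _ hab)

lemma cl_closed {ω : G.edgeSet → Bool} {x : V} {A : Set V} (hx : x ∈ A)
    (hc : ∀ a ∈ A, ∀ b, OA ω a b → b ∈ A) {y : V} (hy : y ∈ Cl ω x) : y ∈ A :=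
  reach_closed hx hc (mem_cl.1 hy)

lemma oa_mono {ω ω' : G.edgeSet → Bool} (h : ω ≤ ω') {a b : V} (hab : OA ω a b) : OA ω' a b := by
  rw [occ_adj] at *
  obtain ⟨h1, h2⟩ := hab
  refine ⟨h1, ?_⟩
  have := h ⟨s(a,b), h1⟩
  rw [h2] at this
  exact this rfl

lemma cl_mono {ω ω' : G.edgeSet → Bool} (h : ω ≤ ω') (x : V) : Cl ω x ⊆ Cl ω' x := by
  intro y hy
  exact cl_closed (A := {z | z ∈ Cl ω' x}) (self_mem_cl _ _)
    (fun a ha b hab => cl_step ha (oa_mono h hab)) hy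

lemma conn_inc (x y : V) : Inc (fun ω : G.edgeSet → Bool => y ∈ Cl ω x) :=
  fun _ _ h hy => cl_mono h x hy

/-- bonds with no endpoint in A -/
def off (G : SimpleGraph V) (A : Finset V) : Set G.edgeSet := {e | ∀ a ∈ A, a ∉ e.1}

lemma cl_dep {ω ω' : G.edgeSet → Bool} {x : V} {A : Finset V} (h : ∀ e ∉ off G A, ω e = ω' e)
    (hA : Cl ω x = A) : Cl ω' x = A := by
  have key : ∀ a ∈ A, ∀ b, (OA ω a b ↔ OA ω' a b) := by
    intro a ha b
    rw [occ_adj, occ_adj]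
    refine exists_congr fun hab => ?_
    rw [h]
    intro hh
    exact hh a ha (by simp)
  have hxA : x ∈ A := hA ▸ self_mem_cl ω x
  have hcl : ∀ a ∈ A, ∀ b, OA ω a b → b ∈ A := by
    intro a ha b hab
    subst hA; exact cl_step ha hab
  apply Finset.Subset.antisymm
  · intro y hy
    exact cl_closed (A := {z | z ∈ A}) hxA (fun a ha b hab => hcl a ha b ((key a ha b).2 hab)) hy
  · intro y hy
    rw [← hA] at hy
    exact (cl_closed (A := {z | z ∈ A ∧ z ∈ Cl ω' x}) ⟨hxA, self_mem_cl _ _⟩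
      (fun a ha b hab => ⟨hcl a ha.1 b hab, cl_step ha.2 ((key a ha.1 b).1 hab)⟩) hy).2

lemma oa_restr {ω : G.edgeSet → Bool} {S : Set G.edgeSet} {a b : V} :
    OA (restr ω S) a b ↔ ∃ h : G.Adj a b, ω ⟨s(a,b), h⟩ = true ∧ (⟨s(a,b), h⟩ : G.edgeSet) ∈ S := by
  rw [occ_adj]; simp [restr]

lemma cl_off {ω : G.edgeSet → Bool} {x v : V} (hv : v ∉ Cl ω x) :
    Cl (restr ω (off G (Cl ω x))) v = Cl ω v := by
  apply Finset.Subset.antisymm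
  · exact cl_mono (restr_le _ _) v
  · intro y hy
    refine (cl_closed (A := {z | z ∉ Cl ω x ∧ z ∈ Cl (restr ω (off G (Cl ω x))) v})
      ⟨hv, self_mem_cl _ _⟩ ?_ hy).2
    rintro a ⟨ha1, ha2⟩ b hab
    have hb : b ∉ Cl ω x := fun hb => ha1 (cl_step hb hab.symm)
    refine ⟨hb, cl_step ha2 ?_⟩
    obtain ⟨h1, h2⟩ := (occ_adj _ _ _).1 hab
    refine oa_restr.2 ⟨h1, h2, ?_⟩
    intro c hc hc'
    simp only [Sym2.mem_iff] at hc'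
    rcases hc' with rfl | rfl
    · exact ha1 hc
    · exact hb hc

/-- cluster of `v` using only bonds that avoid `A` -/
abbrev ClO (ω : G.edgeSet → Bool) (A : Finset V) (v : V) : Finset V := Cl (restr ω (off G A)) v

theorem decouple (p : ℝ) (x v : V) (H : Finset V → Finset V → ℝ) :
    Ex p (fun ω : G.edgeSet → Bool => ind (v ∉ Cl ω x) * H (Cl ω x) (Cl ω v)) =
    Ex p (fun ω : G.edgeSet → Bool => ind (v ∉ Cl ω x) *
      Ex p (fun ω' : G.edgeSet → Bool => H (Cl ω x) (ClO ω' (Cl ω x) v))) := by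
  have h1 : ∀ ω : G.edgeSet → Bool, ind (v ∉ Cl ω x) * H (Cl ω x) (Cl ω v) =
      ∑ A : Finset V, ind (Cl ω x = A) * (ind (v ∉ A) * H A (ClO ω A v)) := by
    intro ω
    rw [Finset.sum_eq_single (Cl ω x)]
    · rw [ind_true rfl, one_mul]
      by_cases hv : v ∉ Cl ω x
      · rw [ClO, cl_off hv]
      · rw [ind_false hv]; simp
    · intro A _ hA; rw [ind_false (fun h => hA h.symm)]; simp
    · simp
  have h2 : ∀ ω : G.edgeSet → Bool, ind (v ∉ Cl ω x) *
      Ex p (fun ω' : G.edgeSet → Bool => H (Cl ω x) (ClO ω' (Cl ω x) v)) =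
      ∑ A : Finset V, ind (Cl ω x = A) * (ind (v ∉ A) * Ex p (fun ω' : G.edgeSet → Bool => H A (ClO ω' A v))) := by
    intro ω
    rw [Finset.sum_eq_single (Cl ω x)]
    · rw [ind_true rfl, one_mul]
    · intro A _ hA; rw [ind_false (fun h => hA h.symm)]; simp
    · simp
  simp only [h1, h2]
  rw [Ex_sum, Ex_sum]
  refine Finset.sum_congr rfl fun A _ => ?_
  rw [Ex_mul_const, ← Ex_const_mul]
  refine Ex_indep p (off G A)ᶜ _ _ ?_ ?_
  · intro ω ω' h
    refine ind_congr ⟨cl_dep fun e he => h e he, cl_dep fun e he => (h e he).symm⟩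
  · intro ω ω' h
    have : restr ω (off G A) = restr ω' (off G A) := by
      funext e
      by_cases he : e ∈ off G A
      · simp [restr, he, h e (by simpa using he)]
      · simp [restr, he]
    show _ * H A (Cl (restr ω (off G A)) v) = _ * H A (Cl (restr ω' (off G A)) v)
    rw [this]

lemma upd_true_ge (ω : G.edgeSet → Bool) (e : G.edgeSet) : ω ≤ upd ω e true := by
  intro e'
  by_cases h : e' = e
  · subst h; simp [upd]
  · simp [upd, h]

lemma upd_false_le (ω : G.edgeSet → Bool) (e : G.edgeSet) : upd ω e false ≤ ω := by
  intro e'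
  by_cases h : e' = e
  · subst h; simp [upd]
  · simp [upd, h]

lemma oa_upd {ω : G.edgeSet → Bool} {u v : V} {h : G.Adj u v} {a b : V} (hh : OA (upd ω ⟨s(u,v), h⟩ true) a b) :
    OA ω a b ∨ (a = u ∧ b = v) ∨ (a = v ∧ b = u) := by
  obtain ⟨h1, h2⟩ := (occ_adj _ _ _).1 hh
  by_cases he : s(a,b) = s(u,v)
  · right; simpa using he
  · left
    refine (occ_adj _ _ _).2 ⟨h1, ?_⟩
    have : (⟨s(a,b), h1⟩ : G.edgeSet) ≠ ⟨s(u,v), h⟩ := fun h' => he (congrArg Subtype.val h')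
    simpa [upd, this] using h2

lemma oa_upd_self (ω : G.edgeSet → Bool) {u v : V} (h : G.Adj u v) : OA (upd ω ⟨s(u,v), h⟩ true) u v :=
  (occ_adj _ _ _).2 ⟨h, by simp [upd]⟩

lemma cl_upd_pivot {ω : G.edgeSet → Bool} {u v x : V} (h : G.Adj u v) (hu : u ∈ Cl ω x) (hv : v ∉ Cl ω x) :
    Cl (upd ω ⟨s(u,v), h⟩ true) x = Cl ω x ∪ Cl ω v := by
  apply Finset.Subset.antisymm
  · intro y hy
    have := cl_closed (A := {z | z ∈ Cl ω x ∪ Cl ω v}) (by simp [self_mem_cl]) ?_ hy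
    · exact this
    · rintro a ha b hab
      simp only [Set.mem_ofPred_eq, Finset.mem_union] at ha ⊢
      rcases oa_upd hab with h1 | ⟨rfl, rfl⟩ | ⟨rfl, rfl⟩
      · exact ha.imp (fun h => cl_step h h1) (fun h => cl_step h h1)
      · exact Or.inr (self_mem_cl _ _)
      · exact Or.inl hu
  · apply Finset.union_subset (cl_mono (upd_true_ge _ _) _)
    intro y hy
    exact mem_cl_trans (cl_step (cl_mono (upd_true_ge _ _) _ hu) (oa_upd_self ω h)) (cl_mono (upd_true_ge _ _) _ hy)

lemma cl_upd_same {ω : G.edgeSet → Bool} {u v x : V} (h : G.Adj u v) (huv : u ∈ Cl ω x ↔ v ∈ Cl ω x) :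
    Cl (upd ω ⟨s(u,v), h⟩ true) x = Cl ω x := by
  apply Finset.Subset.antisymm
  · intro y hy
    refine cl_closed (A := {z | z ∈ Cl ω x}) (self_mem_cl _ _) ?_ hy
    rintro a ha b hab
    simp only [Set.mem_ofPred_eq] at ha ⊢
    rcases oa_upd hab with h1 | ⟨rfl, rfl⟩ | ⟨rfl, rfl⟩
    · exact cl_step ha h1
    · exact huv.1 ha
    · exact huv.2 ha
  · exact cl_mono (upd_true_ge _ _) _

/-- increment along a directed bond -/
def inc (f : ℕ → ℝ) (x u v : V) (ω : G.edgeSet → Bool) : ℝ :=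
  ind (v ∉ Cl ω x) * (ind (u ∈ Cl ω x) * (f ((Cl ω x).card + (Cl ω v).card) - f (Cl ω x).card))

lemma upd_diff (f : ℕ → ℝ) (x : V) {u v : V} (h : G.Adj u v) (ω : G.edgeSet → Bool) :
    f (Cl (upd ω ⟨s(u,v), h⟩ true) x).card - f (Cl ω x).card = inc f x u v ω + inc f x v u ω := by
  unfold inc
  by_cases hu : u ∈ Cl ω x <;> by_cases hv : v ∈ Cl ω x
  · rw [cl_upd_same h (by tauto)]; simp [ind, hu, hv]
  · rw [cl_upd_pivot h hu hv, Finset.card_union_of_disjoint (cl_disj hv)]; simp [ind, hu, hv]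
  · have e : (⟨s(u,v), h⟩ : G.edgeSet) = ⟨s(v,u), h.symm⟩ := by simp [Sym2.eq_swap]
    rw [e, cl_upd_pivot h.symm hv hu, Finset.card_union_of_disjoint (cl_disj hu)]; simp [ind, hu, hv]
  · rw [cl_upd_same h (by tauto)]; simp [ind, hu, hv]

lemma sum_edges (F : G.edgeSet → ℝ) (D : V → V → ℝ)
    (hF : ∀ u v (h : G.Adj u v), F ⟨s(u,v), h⟩ = D u v + D v u) :
    ∑ e, F e = ∑ u, ∑ v, if G.Adj u v then D u v else 0 := by
  have h1 : ∑ u, ∑ v, (if G.Adj u v then D u v else 0) = ∑ d : G.Dart, D d.fst d.snd := by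
    rw [← Fintype.sum_prod_type']
    rw [← Finset.sum_filter]
    symm
    refine Finset.sum_bij (fun d _ => d.toProd) ?_ ?_ ?_ ?_
    · intro d _; simp [d.adj]
    · intro d _ d' _ h; exact SimpleGraph.Dart.ext _ _ h
    · rintro ⟨a, b⟩ hab
      simp only [Finset.mem_filter, Finset.mem_univ, true_and] at hab
      exact ⟨⟨(a, b), hab⟩, Finset.mem_univ _, rfl⟩
    · intro d _; rfl
  rw [h1]
  have h2 := Finset.sum_fiberwise (Finset.univ : Finset G.Dart)
    (fun d => (⟨d.edge, d.edge_mem⟩ : G.edgeSet)) (fun d => D d.fst d.snd)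
  rw [← h2]
  refine Finset.sum_congr rfl ?_
  rintro ⟨e, he⟩ _
  induction e using Sym2.ind with
  | _ u v =>
    have huv : G.Adj u v := he
    rw [hF u v huv]
    have : (Finset.univ.filter fun d : G.Dart => (⟨d.edge, d.edge_mem⟩ : G.edgeSet) = ⟨s(u,v), he⟩)
        = {⟨(u,v), huv⟩, ⟨(v,u), huv.symm⟩} := by
      ext d
      simp only [Finset.mem_filter, Finset.mem_univ, true_and, Finset.mem_insert, Finset.mem_singleton,
        Subtype.mk.injEq]
      constructor
      · intro hd
        have hd' : s(d.fst, d.snd) = s(u,v) := hd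
        rw [Sym2.eq_iff] at hd'
        rcases hd' with ⟨a, b⟩ | ⟨a, b⟩
        · left; exact SimpleGraph.Dart.ext _ _ (Prod.ext a b)
        · right; exact SimpleGraph.Dart.ext _ _ (Prod.ext a b)
      · rintro (rfl | rfl)
        · rfl
        · exact Sym2.eq_swap
    rw [this, Finset.sum_pair]
    intro hh
    have := congrArg (fun d : G.Dart => d.fst) hh
    exact huv.ne this

/-- Russo's formula for functions of the cluster size -/
theorem russo (f : ℕ → ℝ) (x : V) (p : ℝ) :
    (1 - p) * ∑ e, Ex p (dif (fun ω : G.edgeSet → Bool => f (Cl ω x).card) e) =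
    ∑ u, ∑ v, if G.Adj u v then Ex p (inc (G := G) f x u v) else 0 := by
  rw [Finset.mul_sum]
  apply sum_edges
  intro u v h
  rw [← Ex_add]
  set e : G.edgeSet := ⟨s(u,v), h⟩
  have : (fun ω => inc f x u v ω + inc f x v u ω) = fun ω : G.edgeSet → Bool =>
      f (Cl (upd ω e true) x).card - f (Cl ω x).card := by
    funext ω; rw [upd_diff f x h]
  rw [this, Ex_coord p e (fun ω => f (Cl (upd ω e true) x).card - f (Cl ω x).card), ← Ex_const_mul]
  congr 1
  funext ω
  simp [dif, upd]

lemma Ex_equiv {E : Type*} [Fintype E] (σ : E ≃ E) (p : ℝ) (f : (E → Bool) → ℝ) :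
    Ex p (fun ω => f (ω ∘ σ)) = Ex p f := by
  unfold Ex
  refine Fintype.sum_equiv (Equiv.arrowCongr σ.symm (Equiv.refl Bool)) _ _ ?_
  intro ω
  have h1 : (Equiv.arrowCongr σ.symm (Equiv.refl Bool)) ω = ω ∘ σ := by
    funext e; simp [Equiv.arrowCongr]
  rw [h1]
  congr 1
  unfold wt
  exact (Equiv.prod_comp σ (fun e => if ω e then p else 1 - p)).symm

lemma cl_aut (φ : G ≃g G) (ω : G.edgeSet → Bool) (x y : V) :
    φ y ∈ Cl ω (φ x) ↔ y ∈ Cl (ω ∘ φ.mapEdgeSet) x := by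
  have key : ∀ a b, OA ω (φ a) (φ b) ↔ OA (ω ∘ φ.mapEdgeSet) a b := by
    intro a b
    rw [occ_adj, occ_adj]
    constructor
    · rintro ⟨h, h'⟩; exact ⟨φ.map_adj_iff.1 h, h'⟩
    · rintro ⟨h, h'⟩; exact ⟨φ.map_adj_iff.2 h, h'⟩
  constructor
  · intro h
    have := cl_closed (A := {z | φ.symm z ∈ Cl (ω ∘ φ.mapEdgeSet) x}) (x := φ x) (by simp [self_mem_cl]) ?_ h
    · simpa using this
    · intro a ha b hab
      simp only [Set.mem_ofPred_eq] at *
      refine cl_step ha ?_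
      rw [← key]; simpa using hab
  · intro h
    refine cl_closed (A := {z | φ z ∈ Cl ω (φ x)}) (x := x) (self_mem_cl _ _) ?_ h
    intro a ha b hab
    exact cl_step ha ((key _ _).2 hab)

/-- two-point function -/
def T (G : SimpleGraph V) (p : ℝ) (x y : V) : ℝ := Ex p (fun ω : G.edgeSet → Bool => ind (y ∈ Cl ω x))

lemma tau_eq (p : ℝ) (x y : V) : tau G p x y = T G p x y := by
  unfold tau T
  simp only [mem_cl]
  exact prob_eq p (fun ω : G.edgeSet → Bool => (occupied G ω).Reachable x y)

lemma T_aut (φ : G ≃g G) (p : ℝ) (x y : V) : T G p (φ x) (φ y) = T G p x y := by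
  unfold T
  rw [← Ex_equiv φ.mapEdgeSet p (fun ω => ind (y ∈ Cl ω x))]
  simp only [ind_congr (cl_aut φ _ x y)]

lemma card_aut (φ : G ≃g G) (ω : G.edgeSet → Bool) (x : V) :
    (Cl ω (φ x)).card = (Cl (ω ∘ φ.mapEdgeSet) x).card := by
  have : Cl ω (φ x) = (Cl (ω ∘ φ.mapEdgeSet) x).map φ.toEquiv.toEmbedding := by
    ext y
    rw [Finset.mem_map_equiv, ← cl_aut]
    have : φ (φ.toEquiv.symm y) = y := φ.toEquiv.apply_symm_apply y
    rw [this]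
  rw [this, Finset.card_map]

lemma Ex_card_eq (hT : IsTransitive G) (p : ℝ) (f : ℕ → ℝ) (x y : V) :
    Ex p (fun ω : G.edgeSet → Bool => f (Cl ω x).card) = Ex p (fun ω : G.edgeSet → Bool => f (Cl ω y).card) := by
  obtain ⟨φ, rfl⟩ := hT x y
  simp only [card_aut]
  exact (Ex_equiv φ.mapEdgeSet p (fun ω => f (Cl ω x).card)).symm

lemma T_symm (p : ℝ) (x y : V) : T G p x y = T G p y x := by
  unfold T; simp only [ind_congr (mem_cl_comm (x := x) (y := y))]

lemma T_nonneg {p : ℝ} (h0 : 0 ≤ p) (h1 : p ≤ 1) (x y : V) : 0 ≤ T G p x y :=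
  Ex_nonneg h0 h1 fun _ => ind_nonneg _

lemma T_self (p : ℝ) (x : V) : T G p x x = 1 := by
  unfold T; simp only [ind_true (self_mem_cl _ x), Ex_one]

lemma card_eq_sum (A : Finset V) : (A.card : ℝ) = ∑ y, ind (y ∈ A) := by
  rw [Finset.card_eq_sum_ones, Nat.cast_sum]
  rw [← Finset.sum_subset (Finset.subset_univ A) (fun y _ hy => ind_false hy)]
  exact Finset.sum_congr rfl fun y hy => by rw [ind_true hy]; simp

lemma sum_T (p : ℝ) (x : V) : ∑ y, T G p x y = Ex p (fun ω : G.edgeSet → Bool => ((Cl ω x).card : ℝ)) := by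
  simp only [card_eq_sum, T]; rw [Ex_sum]

end graph
end PW

set_option linter.unusedSectionVars false

namespace PW
open Percolation

section bkapp
variable {V : Type} [Fintype V] {G : SimpleGraph V}

lemma walk_restr {ω : G.edgeSet → Bool} {a b : V} (w : (occupied G ω).Walk a b) (S : Set G.edgeSet)
    (h : ∀ e : G.edgeSet, e.1 ∈ w.edges → e ∈ S) : b ∈ Cl (restr ω S) a := by
  induction w with
  | nil => exact self_mem_cl _ _
  | @cons u v w' huv p ih =>
    have h1 := ih (fun e he => h e (by simp [he]))
    refine mem_cl_trans ?_ h1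
    refine cl_step (self_mem_cl _ _) ?_
    obtain ⟨hh, hh'⟩ := (occ_adj _ _ _).1 huv
    exact oa_restr.2 ⟨hh, hh', h _ (by simp)⟩

lemma exists_path {ω : G.edgeSet → Bool} {x y : V} (h : y ∈ Cl ω x) :
    ∃ π : (occupied G ω).Walk x y, π.IsPath := by
  obtain ⟨w⟩ := mem_cl.1 h
  exact ⟨w.toPath.1, w.toPath.2⟩

lemma path_split {ω : G.edgeSet → Bool} {x y a : V} (π : (occupied G ω).Walk x y) (hπ : π.IsPath)
    (ha : a ∈ π.support) : ∃ S₁ S₂ : Set G.edgeSet, Disjoint S₁ S₂ ∧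
      (∀ e, e ∈ S₁ ∪ S₂ → e.1 ∈ π.edges) ∧ a ∈ Cl (restr ω S₁) x ∧ y ∈ Cl (restr ω S₂) a := by
  have hsp := π.take_spec ha
  have hed : π.edges = (π.takeUntil a ha).edges ++ (π.dropUntil a ha).edges := by
    conv_lhs => rw [← hsp]
    exact SimpleGraph.Walk.edges_append _ _
  have hnd : π.edges.Nodup := hπ.isTrail.edges_nodup
  refine ⟨{e | e.1 ∈ (π.takeUntil a ha).edges}, {e | e.1 ∈ (π.dropUntil a ha).edges}, ?_, ?_, ?_, ?_⟩
  · rw [Set.disjoint_left]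
    intro e h1 h2
    rw [hed, List.nodup_append] at hnd
    exact hnd.2.2 _ h1 _ h2 rfl
  · intro e he
    rw [hed, List.mem_append]
    exact he
  · exact walk_restr _ _ fun e he => he
  · exact walk_restr _ _ fun e he => he

lemma hit_path {ω : G.edgeSet → Bool} (Su : Set V) (S : Set G.edgeSet)
    (hS : ∀ e ∈ S, ∀ v ∈ e.1, v ∈ Su) {y z : V} (w : (occupied G ω).Walk y z) (hz : z ∈ Su) :
    ∃ u ∈ Su, y ∈ Cl (restr ω Sᶜ) u := by
  induction w with
  | nil => exact ⟨_, hz, self_mem_cl _ _⟩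
  | @cons y b z' hyb p ih =>
    by_cases hy : y ∈ Su
    · exact ⟨y, hy, self_mem_cl _ _⟩
    · obtain ⟨u, hu, hb⟩ := ih hz
      refine ⟨u, hu, cl_step hb ?_⟩
      obtain ⟨hh, hh'⟩ := (occ_adj _ _ _).1 hyb
      refine SimpleGraph.Adj.symm (oa_restr.2 ⟨hh, hh', ?_⟩)
      intro he
      exact hy (hS _ he y (by simp))

lemma restr_restr_le {ω : G.edgeSet → Bool} {S S' T : Set G.edgeSet} (h : T ⊆ S ∩ S') :
    restr ω T ≤ restr (restr ω S) S' := by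
  intro e
  by_cases he : e ∈ T
  · have := h he
    simp [restr, he, this.1, this.2]
  · simp [restr, he]

lemma tree_event {ω : G.edgeSet → Bool} {o x y : V} (hx : x ∈ Cl ω o) (hy : y ∈ Cl ω o) :
    ∃ w, DO (fun ω : G.edgeSet → Bool => w ∈ Cl ω o)
      (DO (fun ω => x ∈ Cl ω w) (fun ω => y ∈ Cl ω w)) ω := by
  obtain ⟨π, hπ⟩ := exists_path hx
  obtain ⟨q⟩ := mem_cl.1 (mem_cl_symm hy)
  obtain ⟨w, hw, hyw⟩ := hit_path {v | v ∈ π.support} {e | e.1 ∈ π.edges} (by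
    rintro ⟨e, he⟩ hee v hv
    exact π.mem_support_of_mem_edges hee hv) q (by simp)
  obtain ⟨S₁, S₂, hd, hsub, h1, h2⟩ := path_split π hπ hw
  refine ⟨w, S₁, h1, S₂, ?_, ?_⟩
  · refine cl_mono (restr_restr_le ?_) _ h2
    intro e he
    exact ⟨fun h => (Set.disjoint_left.1 hd h he), he⟩
  · refine cl_mono (restr_restr_le ?_) _ hyw
    intro e he
    exact ⟨fun h => he (hsub e (Or.inl h)), fun h => he (hsub e (Or.inr h))⟩

/-- tree-graph inequality -/
theorem tree_graph {p : ℝ} (h0 : 0 ≤ p) (h1 : p ≤ 1) (o x y : V) :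
    Ex p (fun ω : G.edgeSet → Bool => ind (x ∈ Cl ω o) * ind (y ∈ Cl ω o)) ≤
      ∑ w, T G p o w * T G p w x * T G p w y := by
  have hb : ∀ w, Ex p (fun ω : G.edgeSet → Bool => ind (DO (fun ω : G.edgeSet → Bool => w ∈ Cl ω o)
      (DO (fun ω => x ∈ Cl ω w) (fun ω => y ∈ Cl ω w)) ω)) ≤ T G p o w * T G p w x * T G p w y := by
    intro w
    refine (BK (conn_inc o w) (DO_inc (conn_inc w x) (conn_inc w y)) h0 h1).trans ?_
    rw [mul_assoc]
    refine mul_le_mul_of_nonneg_left ?_ (T_nonneg h0 h1 o w)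
    exact BK (conn_inc w x) (conn_inc w y) h0 h1
  refine le_trans ?_ (Finset.sum_le_sum fun w _ => hb w)
  rw [← Ex_sum]
  refine Ex_mono h0 h1 fun ω => ?_
  by_cases hx : x ∈ Cl ω o
  · by_cases hy : y ∈ Cl ω o
    · obtain ⟨w, hw⟩ := tree_event hx hy
      rw [ind_true hx, ind_true hy, mul_one]
      refine le_trans (ind_true hw).ge ?_
      exact Finset.single_le_sum (f := fun w => ind (DO (fun ω : G.edgeSet → Bool => w ∈ Cl ω o)
        (DO (fun ω => x ∈ Cl ω w) (fun ω => y ∈ Cl ω w)) ω)) (fun _ _ => ind_nonneg _) (Finset.mem_univ w)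
    · rw [ind_false hy, mul_zero]; exact Finset.sum_nonneg fun _ _ => ind_nonneg _
  · rw [ind_false hx, zero_mul]; exact Finset.sum_nonneg fun _ _ => ind_nonneg _

lemma through_event {ω : G.edgeSet → Bool} {A : Finset V} {v y : V} (hy : y ∈ Cl ω v) :
    y ∈ ClO ω A v ∨ ∃ a ∈ A, DO (fun ω : G.edgeSet → Bool => a ∈ Cl ω v) (fun ω => y ∈ Cl ω a) ω := by
  obtain ⟨π, hπ⟩ := exists_path hy
  by_cases h : ∃ a ∈ A, a ∈ π.support
  · right
    obtain ⟨a, haA, ha⟩ := h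
    obtain ⟨S₁, S₂, hd, hsub, h1, h2⟩ := path_split π hπ ha
    refine ⟨a, haA, S₁, h1, ?_⟩
    refine cl_mono (restr_mono le_rfl ?_) _ h2
    intro e he h'
    exact Set.disjoint_left.1 hd h' he
  · left
    push Not at h
    refine walk_restr π _ ?_
    intro e he a ha hae
    exact h a ha (π.mem_support_of_mem_edges he hae)

theorem through_bound {p : ℝ} (h0 : 0 ≤ p) (h1 : p ≤ 1) (A : Finset V) (v y : V) :
    T G p v y - ∑ a, ind (a ∈ A) * (T G p v a * T G p a y) ≤
      Ex p (fun ω : G.edgeSet → Bool => ind (y ∈ ClO ω A v)) := by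
  have hb : ∀ a, ind (a ∈ A) * Ex p (fun ω : G.edgeSet → Bool => ind (DO (fun ω : G.edgeSet → Bool => a ∈ Cl ω v)
      (fun ω => y ∈ Cl ω a) ω)) ≤ ind (a ∈ A) * (T G p v a * T G p a y) := fun a =>
    mul_le_mul_of_nonneg_left (BK (conn_inc v a) (conn_inc a y) h0 h1) (ind_nonneg _)
  have hs := Finset.sum_le_sum fun a (_ : a ∈ Finset.univ) => hb a
  suffices T G p v y ≤ Ex p (fun ω : G.edgeSet → Bool => ind (y ∈ ClO ω A v)) +
      ∑ a, ind (a ∈ A) * Ex p (fun ω : G.edgeSet → Bool => ind (DO (fun ω : G.edgeSet → Bool => a ∈ Cl ω v)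
      (fun ω => y ∈ Cl ω a) ω)) by linarith
  simp only [← Ex_const_mul]
  rw [← Ex_sum, ← Ex_add]
  refine Ex_mono h0 h1 fun ω => ?_
  have hnn : 0 ≤ ∑ a, ind (a ∈ A) * ind (DO (fun ω : G.edgeSet → Bool => a ∈ Cl ω v)
      (fun ω => y ∈ Cl ω a) ω) := Finset.sum_nonneg fun _ _ => mul_nonneg (ind_nonneg _) (ind_nonneg _)
  by_cases hy : y ∈ Cl ω v
  · rw [ind_true hy]
    rcases through_event (A := A) hy with h | ⟨a, ha, h⟩
    · rw [ind_true h]; linarith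
    · have := Finset.single_le_sum (f := fun a => ind (a ∈ A) * ind (DO (fun ω : G.edgeSet → Bool => a ∈ Cl ω v)
        (fun ω => y ∈ Cl ω a) ω)) (fun _ _ => mul_nonneg (ind_nonneg _) (ind_nonneg _)) (Finset.mem_univ a)
      simp only [ind_true ha, ind_true h, mul_one] at this
      have := ind_nonneg (y ∈ ClO ω A v)
      linarith
  · rw [ind_false hy]
    exact add_nonneg (ind_nonneg _) hnn

/-- bonds with both ends in A -/
def ins (G : SimpleGraph V) (A : Finset V) : Set G.edgeSet := {e | ∀ v ∈ e.1, v ∈ A}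

lemma ins_mono {A B : Finset V} (h : A ⊆ B) : ins G A ⊆ ins G B := fun _ he v hv => h (he v hv)

lemma oa_ins {ω : G.edgeSet → Bool} {A : Finset V} {a b : V} :
    OA (restr ω (ins G A)) a b ↔ OA ω a b ∧ a ∈ A ∧ b ∈ A := by
  rw [oa_restr, occ_adj]
  constructor
  · rintro ⟨h, h1, h2⟩
    exact ⟨⟨h, h1⟩, h2 a (by simp), h2 b (by simp)⟩
  · rintro ⟨⟨h, h1⟩, h2, h3⟩
    refine ⟨h, h1, ?_⟩
    intro v hv
    simp only [Sym2.mem_iff] at hv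
    rcases hv with rfl | rfl <;> assumption

/-- A is connected inside itself from z -/
def Con (ω : G.edgeSet → Bool) (A : Finset V) (z : V) : Prop := ∀ a ∈ A, a ∈ Cl (restr ω (ins G A)) z

lemma cl_ins_mono {ω : G.edgeSet → Bool} {A B : Finset V} (h : A ⊆ B) (z : V) :
    Cl (restr ω (ins G A)) z ⊆ Cl (restr ω (ins G B)) z := cl_mono (restr_mono le_rfl (ins_mono h)) z

lemma split_aux (ω : G.edgeSet → Bool) (o : V) (n : ℕ) (hn : 1 ≤ n) : ∀ (m : ℕ) (A B : Finset V) (z : V),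
    A.card ≤ m → z ∈ A → z ∈ B → A ∩ B = {z} → Con ω A z → Con ω B o → n ≤ A.card →
    3 * n ≤ (A ∪ B).card →
    DO (fun ω : G.edgeSet → Bool => n ≤ (Cl ω o).card) (fun ω => ∃ x, n ≤ (Cl ω x).card) ω := by
  intro m
  induction m with
  | zero =>
    intro A B z hm hz
    exfalso
    have := Finset.card_pos.2 ⟨z, hz⟩
    omega
  | succ m ih =>
    intro A B z hm hzA hzB hAB hA hB hnA hU
    by_cases hle : A.card ≤ 2 * n
    · refine ⟨ins G B, ?_, z, ?_⟩
      · have h1 : B ⊆ Cl (restr ω (ins G B)) o := fun b hb => hB b hb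
        have h2 := Finset.card_le_card h1
        have h3 := Finset.card_union_le A B
        show n ≤ _
        omega
      · have h1 : A ⊆ Cl (restr ω (ins G B)ᶜ) z := by
          intro a ha
          refine cl_mono (restr_mono le_rfl ?_) _ (hA a ha)
          rintro ⟨e, he⟩ h1 h2
          induction e using Sym2.ind with
          | _ u v =>
            have hu : u ∈ A ∩ B := Finset.mem_inter.2 ⟨h1 u (by simp), h2 u (by simp)⟩
            have hv : v ∈ A ∩ B := Finset.mem_inter.2 ⟨h1 v (by simp), h2 v (by simp)⟩
            rw [hAB, Finset.mem_singleton] at hu hv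
            have hadj : G.Adj u v := he
            exact hadj.ne (hu.trans hv.symm)
        exact hnA.trans (Finset.card_le_card h1)
    · push Not at hle
      have hex : ∃ z' ∈ A, z' ≠ z ∧ OA ω z z' := by
        by_contra hcon
        push Not at hcon
        have : A ⊆ {z} := by
          intro a ha
          have := cl_closed (A := {z}) (by simp) ?_ (hA a ha)
          · simpa using this
          · rintro c hc b hcb
            rw [Set.mem_singleton_iff] at hc
            subst hc
            obtain ⟨h1, h2, h3⟩ := oa_ins.1 hcb
            by_contra hb
            exact hcon b h3 hb h1
        have := Finset.card_le_card this
        simp at this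
        omega
      obtain ⟨z', hz'A, hz'z, hadj⟩ := hex
      set K := Cl (restr ω (ins G (A.erase z))) z' with hK
      have hz'K : z' ∈ K := self_mem_cl _ _
      have hKsub : K ⊆ A.erase z := by
        intro a ha
        exact cl_closed (A := {a | a ∈ A.erase z}) (by simp [hz'A, hz'z])
          (fun c _ b hcb => (oa_ins.1 hcb).2.2) ha
      have hKA : K ⊆ A := hKsub.trans (Finset.erase_subset _ _)
      have hzK : z ∉ K := fun h => by simpa using hKsub h
      have hKcon : Con ω K z' := by
        intro a ha
        refine (cl_closed (A := {a | a ∈ K ∧ a ∈ Cl (restr ω (ins G K)) z'}) ⟨hz'K, self_mem_cl _ _⟩ ?_ ha).2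
        rintro c ⟨hc1, hc2⟩ b hcb
        have hb : b ∈ K := cl_step hc1 hcb
        exact ⟨hb, cl_step hc2 (oa_ins.2 ⟨(oa_ins.1 hcb).1, hc1, hb⟩)⟩
      have hRcon : Con ω (A \ K) z := by
        intro a ha
        have := cl_closed (A := {a | a ∈ K ∨ (a ∈ A \ K ∧ a ∈ Cl (restr ω (ins G (A \ K))) z)})
          (Or.inr ⟨by simp [hzA, hzK], self_mem_cl _ _⟩) ?_ (hA a (Finset.mem_sdiff.1 ha).1)
        · rcases this with h | h
          · exact absurd h (Finset.mem_sdiff.1 ha).2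
          · exact h.2
        · rintro c hc b hcb
          obtain ⟨h1, h2, h3⟩ := oa_ins.1 hcb
          by_cases hbK : b ∈ K
          · exact Or.inl hbK
          · right
            have hbR : b ∈ A \ K := Finset.mem_sdiff.2 ⟨h3, hbK⟩
            refine ⟨hbR, ?_⟩
            rcases hc with hc | hc
            · by_cases hbz : b = z
              · subst hbz; exact self_mem_cl _ _
              · exfalso
                apply hbK
                refine cl_step hc (oa_ins.2 ⟨h1, hKsub hc, ?_⟩)
                simp [hbz, h3]
            · exact cl_step hc.2 (oa_ins.2 ⟨h1, hc.1, hbR⟩)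
      have hBA : ∀ a, a ∈ A → a ∈ B → a = z := by
        intro a h1 h2
        have : a ∈ A ∩ B := Finset.mem_inter.2 ⟨h1, h2⟩
        rwa [hAB, Finset.mem_singleton] at this
      by_cases hKn : n ≤ K.card
      · refine ih K (B ∪ (A \ K) ∪ {z'}) z' ?_ hz'K (by simp) ?_ hKcon ?_ hKn ?_
        · have := Finset.card_lt_card (Finset.ssubset_iff_subset_ne.2 ⟨hKA, fun h => hzK (h ▸ hzA)⟩)
          omega
        · ext a
          simp only [Finset.mem_inter, Finset.mem_union, Finset.mem_sdiff, Finset.mem_singleton]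
          constructor
          · rintro ⟨h1, (h2 | h2) | h2⟩
            · exact absurd (hBA a (hKA h1) h2 ▸ h1) hzK
            · exact absurd h1 h2.2
            · exact h2
          · rintro rfl; exact ⟨hz'K, Or.inr rfl⟩
        · have hz : z ∈ Cl (restr ω (ins G (B ∪ (A \ K) ∪ {z'}))) o :=
            cl_ins_mono (by intro; simp; tauto) _ (hB z hzB)
          intro a ha
          simp only [Finset.mem_union, Finset.mem_singleton] at ha
          rcases ha with (h | h) | h
          · exact cl_ins_mono (by intro; simp; tauto) _ (hB a h)
          · exact mem_cl_trans hz (cl_ins_mono (by intro; simp; tauto) _ (hRcon a h))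
          · subst h
            exact cl_step hz (oa_ins.2 ⟨hadj, by simp [hzB], by simp⟩)
        · refine hU.trans (Finset.card_le_card ?_)
          intro a; simp; tauto
      · refine ih (A \ K) (B ∪ K) z ?_ (by simp [hzA, hzK]) (by simp [hzB]) ?_ hRcon ?_ ?_ ?_
        · have : A \ K ⊂ A := Finset.ssubset_iff_subset_ne.2 ⟨Finset.sdiff_subset, fun h => by
            have := h ▸ hz'A
            exact (Finset.mem_sdiff.1 this).2 hz'K⟩
          have := Finset.card_lt_card this
          omega
        · ext a
          simp only [Finset.mem_inter, Finset.mem_union, Finset.mem_sdiff, Finset.mem_singleton]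
          constructor
          · rintro ⟨⟨h1, h2⟩, h3 | h3⟩
            · exact hBA a h1 h3
            · exact absurd h3 h2
          · rintro rfl; exact ⟨⟨hzA, hzK⟩, Or.inl hzB⟩
        · have hz : z ∈ Cl (restr ω (ins G (B ∪ K))) o :=
            cl_ins_mono (by intro; simp; tauto) _ (hB z hzB)
          have hz' : z' ∈ Cl (restr ω (ins G (B ∪ K))) o :=
            cl_step hz (oa_ins.2 ⟨hadj, by simp [hzB], by simp [hz'K]⟩)
          intro a ha
          simp only [Finset.mem_union] at ha
          rcases ha with h | h
          · exact cl_ins_mono (by intro; simp; tauto) _ (hB a h)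
          · exact mem_cl_trans hz' (cl_ins_mono (by intro; simp; tauto) _ (hKcon a h))
        · have := Finset.card_sdiff_add_card_eq_card hKA
          omega
        · refine hU.trans (Finset.card_le_card ?_)
          intro a; simp; tauto

lemma split_event {ω : G.edgeSet → Bool} {o : V} {n : ℕ} (hn : 1 ≤ n) (h : 3 * n ≤ (Cl ω o).card) :
    DO (fun ω : G.edgeSet → Bool => n ≤ (Cl ω o).card) (fun ω => ∃ x, n ≤ (Cl ω x).card) ω := by
  refine split_aux ω o n hn _ (Cl ω o) {o} o le_rfl (self_mem_cl _ _) (by simp) ?_ ?_ ?_ (by omega) ?_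
  · simp [self_mem_cl]
  · intro a ha
    refine (cl_closed (A := {a | a ∈ Cl ω o ∧ a ∈ Cl (restr ω (ins G (Cl ω o))) o})
      ⟨self_mem_cl _ _, self_mem_cl _ _⟩ ?_ ha).2
    rintro c ⟨h1, h2⟩ b hcb
    exact ⟨cl_step h1 hcb, cl_step h2 (oa_ins.2 ⟨hcb, h1, cl_step h1 hcb⟩)⟩
  · intro a ha
    rw [Finset.mem_singleton] at ha
    subst ha; exact self_mem_cl _ _
  · exact h.trans (Finset.card_le_card Finset.subset_union_left)

lemma card_inc (x : V) (n : ℕ) : Inc (fun ω : G.edgeSet → Bool => n ≤ (Cl ω x).card) :=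
  fun _ _ h hn => hn.trans (Finset.card_le_card (cl_mono h x))

/-- tail probability -/
def q (G : SimpleGraph V) (p : ℝ) (x : V) (n : ℕ) : ℝ :=
  Ex p (fun ω : G.edgeSet → Bool => ind (n ≤ (Cl ω x).card))

/-- tail splitting inequality -/
theorem q_split (hT : IsTransitive G) {p : ℝ} (h0 : 0 ≤ p) (h1 : p ≤ 1) (o : V) {n : ℕ} (hn : 1 ≤ n) :
    n * q G p o (3 * n) ≤ q G p o n * (Fintype.card V * q G p o n) := by
  have a1 : q G p o (3 * n) ≤ q G p o n *
      Ex p (fun ω : G.edgeSet → Bool => ind (∃ x, n ≤ (Cl ω x).card)) := by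
    refine le_trans (Ex_mono h0 h1 fun ω => ind_mono fun h => split_event hn h) ?_
    refine BK (card_inc o n) ?_ h0 h1
    rintro ω ω' h ⟨x, hx⟩
    exact ⟨x, card_inc x n ω ω' h hx⟩
  have a2 : n * Ex p (fun ω : G.edgeSet → Bool => ind (∃ x, n ≤ (Cl ω x).card)) ≤
      Fintype.card V * q G p o n := by
    have : (Fintype.card V : ℝ) * q G p o n = ∑ x : V, q G p x n := by
      have h : ∀ x, q G p x n = q G p o n := fun x => Ex_card_eq hT p (fun m => ind (n ≤ m)) x o
      simp [h]
    rw [this, ← Ex_const_mul]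
    unfold q
    rw [← Ex_sum]
    refine Ex_mono h0 h1 fun ω => ?_
    by_cases h : ∃ x, n ≤ (Cl ω x).card
    · rw [ind_true h, mul_one]
      obtain ⟨x, hx⟩ := h
      calc (n : ℝ) ≤ (Cl ω x).card := by exact_mod_cast hx
        _ = ∑ y, ind (y ∈ Cl ω x) := card_eq_sum _
        _ ≤ _ := Finset.sum_le_sum fun y _ => ind_mono fun hy => by rw [cl_eq hy]; exact hx
    · rw [ind_false h, mul_zero]; exact Finset.sum_nonneg fun _ _ => ind_nonneg _
  have hq : 0 ≤ q G p o n := Ex_nonneg h0 h1 fun _ => ind_nonneg _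
  calc n * q G p o (3 * n) ≤ n * (q G p o n * Ex p (fun ω : G.edgeSet → Bool => ind (∃ x, n ≤ (Cl ω x).card))) :=
        mul_le_mul_of_nonneg_left a1 (Nat.cast_nonneg _)
    _ = q G p o n * (n * Ex p (fun ω : G.edgeSet → Bool => ind (∃ x, n ≤ (Cl ω x).card))) := by ring
    _ ≤ _ := mul_le_mul_of_nonneg_left a2 hq

end bkapp
end PW

set_option linter.unusedSectionVars false
set_option linter.unusedVariables false

namespace PW
open Percolation

section diffineq
variable {V : Type} [Fintype V] {G : SimpleGraph V}

/-- expectation of a function of the cluster size -/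
def M (G : SimpleGraph V) (x : V) (p : ℝ) (f : ℕ → ℝ) : ℝ :=
  Ex p (fun ω : G.edgeSet → Bool => f (Cl ω x).card)

/-- its derivative in p -/
def M' (G : SimpleGraph V) (x : V) (p : ℝ) (f : ℕ → ℝ) : ℝ :=
  ∑ e, Ex p (dif (fun ω : G.edgeSet → Bool => f (Cl ω x).card) e)

lemma hasDerivAt_M (x : V) (f : ℕ → ℝ) (p : ℝ) : HasDerivAt (fun p => M G x p f) (M' G x p f) p :=
  hasDerivAt_Ex _ p

lemma M_mono {p : ℝ} (h0 : 0 ≤ p) (h1 : p ≤ 1) (x : V) {f g : ℕ → ℝ} (h : ∀ n, 1 ≤ n → f n ≤ g n) :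
    M G x p f ≤ M G x p g := Ex_mono h0 h1 fun ω => h _ (Finset.card_pos.2 ⟨x, self_mem_cl _ _⟩)

lemma M_nonneg {p : ℝ} (h0 : 0 ≤ p) (h1 : p ≤ 1) (x : V) {f : ℕ → ℝ} (h : ∀ n, 1 ≤ n → 0 ≤ f n) :
    0 ≤ M G x p f := Ex_nonneg h0 h1 fun ω => h _ (Finset.card_pos.2 ⟨x, self_mem_cl _ _⟩)

lemma M_add (x : V) (p : ℝ) (f g : ℕ → ℝ) : M G x p (fun n => f n + g n) = M G x p f + M G x p g := Ex_add _ _ _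
lemma M_sub (x : V) (p : ℝ) (f g : ℕ → ℝ) : M G x p (fun n => f n - g n) = M G x p f - M G x p g := Ex_sub _ _ _
lemma M_const_mul (x : V) (p c : ℝ) (f : ℕ → ℝ) : M G x p (fun n => c * f n) = c * M G x p f := Ex_const_mul _ _ _
lemma M_const (x : V) (p c : ℝ) : M G x p (fun _ => c) = c := Ex_const _ _

lemma M'_sub (x : V) (p : ℝ) (f g : ℕ → ℝ) : M' G x p (fun n => f n - g n) = M' G x p f - M' G x p g := by
  have h1 := (hasDerivAt_M (G := G) x f p).sub (hasDerivAt_M (G := G) x g p)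
  have h2 := hasDerivAt_M (G := G) x (fun n => f n - g n) p
  have : (fun p => M G x p (fun n => f n - g n)) = (fun p => M G x p f) - (fun p => M G x p g) := by
    funext p; exact M_sub x p f g
  rw [this] at h2
  exact h2.unique h1

lemma sum_adj {Ω : ℝ} (hΩ : ∀ u, ∑ v, (if G.Adj u v then (1:ℝ) else 0) = Ω) (F : V → ℝ) :
    ∑ u, ∑ v, (if G.Adj u v then F u else 0) = Ω * ∑ u, F u := by
  rw [Finset.mul_sum]
  refine Finset.sum_congr rfl fun u _ => ?_
  rw [← hΩ u, Finset.sum_mul]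
  refine Finset.sum_congr rfl fun v _ => ?_
  split_ifs <;> ring

theorem upper_diff (hT : IsTransitive G) {Ω : ℝ} (hΩ : ∀ u, ∑ v, (if G.Adj u v then (1:ℝ) else 0) = Ω)
    {p : ℝ} (h0 : 0 ≤ p) (h1 : p ≤ 1) (x : V) (f g₁ k₁ g₂ k₂ : ℕ → ℝ)
    (hf : ∀ a b, f (a + b) - f a ≤ g₁ a * k₁ b + g₂ a * k₂ b)
    (hg₁ : ∀ a, 0 ≤ g₁ a) (hg₂ : ∀ a, 0 ≤ g₂ a) (hk₁ : Monotone k₁) (hk₂ : Monotone k₂)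
    (hk₁0 : ∀ a, 0 ≤ k₁ a) (hk₂0 : ∀ a, 0 ≤ k₂ a) :
    (1 - p) * M' G x p f ≤ Ω * (M G x p (fun n => n * g₁ n) * M G x p k₁ + M G x p (fun n => n * g₂ n) * M G x p k₂) := by
  unfold M'
  rw [russo]
  have hb : ∀ u v, Ex p (inc (G := G) f x u v) ≤ Ex p (fun ω : G.edgeSet → Bool =>
      ind (u ∈ Cl ω x) * (g₁ (Cl ω x).card * M G x p k₁ + g₂ (Cl ω x).card * M G x p k₂)) := by
    intro u v
    unfold inc
    rw [decouple p x v (fun A B => ind (u ∈ A) * (f (A.card + B.card) - f A.card))]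
    refine Ex_mono h0 h1 fun ω => ?_
    have hM : ∀ k : ℕ → ℝ, M G x p k = Ex p (fun ω : G.edgeSet → Bool => k (Cl ω v).card) := fun k =>
      Ex_card_eq hT p k x v
    rw [hM k₁, hM k₂]
    have hre : ind (u ∈ Cl ω x) * (g₁ (Cl ω x).card * Ex p (fun ω : G.edgeSet → Bool => k₁ (Cl ω v).card) +
        g₂ (Cl ω x).card * Ex p (fun ω : G.edgeSet → Bool => k₂ (Cl ω v).card)) =
        Ex p (fun ω' : G.edgeSet → Bool => ind (u ∈ Cl ω x) *
        (g₁ (Cl ω x).card * k₁ (Cl ω' v).card + g₂ (Cl ω x).card * k₂ (Cl ω' v).card)) := by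
      rw [Ex_const_mul, Ex_add, Ex_const_mul, Ex_const_mul]
    rw [hre]
    have h2 : Ex p (fun ω' : G.edgeSet → Bool => ind (u ∈ Cl ω x) *
        (f ((Cl ω x).card + (ClO ω' (Cl ω x) v).card) - f (Cl ω x).card)) ≤
        Ex p (fun ω' : G.edgeSet → Bool => ind (u ∈ Cl ω x) *
        (g₁ (Cl ω x).card * k₁ (Cl ω' v).card + g₂ (Cl ω x).card * k₂ (Cl ω' v).card)) := by
      refine Ex_mono h0 h1 fun ω' => mul_le_mul_of_nonneg_left ?_ (ind_nonneg _)
      refine (hf _ _).trans ?_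
      have hc : (ClO ω' (Cl ω x) v).card ≤ (Cl ω' v).card := Finset.card_le_card (cl_mono (restr_le _ _) _)
      exact add_le_add (mul_le_mul_of_nonneg_left (hk₁ hc) (hg₁ _)) (mul_le_mul_of_nonneg_left (hk₂ hc) (hg₂ _))
    have h3 : 0 ≤ Ex p (fun ω' : G.edgeSet → Bool => ind (u ∈ Cl ω x) *
        (g₁ (Cl ω x).card * k₁ (Cl ω' v).card + g₂ (Cl ω x).card * k₂ (Cl ω' v).card)) :=
      Ex_nonneg h0 h1 fun ω' => mul_nonneg (ind_nonneg _)
        (add_nonneg (mul_nonneg (hg₁ _) (hk₁0 _)) (mul_nonneg (hg₂ _) (hk₂0 _)))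
    refine le_trans (mul_le_mul_of_nonneg_left h2 (ind_nonneg _)) ?_
    exact mul_le_of_le_one_left h3 (ind_le_one _)
  have h4 : ∑ u, ∑ v, (if G.Adj u v then Ex p (inc (G := G) f x u v) else 0) ≤
      ∑ u, ∑ v, if G.Adj u v then Ex p (fun ω : G.edgeSet → Bool =>
      ind (u ∈ Cl ω x) * (g₁ (Cl ω x).card * M G x p k₁ + g₂ (Cl ω x).card * M G x p k₂)) else 0 := by
    refine Finset.sum_le_sum fun u _ => Finset.sum_le_sum fun v _ => ?_
    split_ifs
    · exact hb u v
    · exact le_rfl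
  refine h4.trans ?_
  rw [sum_adj hΩ, ← Ex_sum]
  apply le_of_eq
  congr 1
  unfold M
  rw [← Ex_mul_const, ← Ex_mul_const, ← Ex_add]
  congr 1
  funext ω
  rw [← Finset.sum_mul, ← card_eq_sum]
  ring

theorem lower_diff (hT : IsTransitive G) {Ω : ℝ} (hΩ : ∀ u, ∑ v, (if G.Adj u v then (1:ℝ) else 0) = Ω)
    {p b : ℝ} (h0 : 0 ≤ p) (h1 : p ≤ 1) (x : V)
    (htri : ∀ u v, G.Adj u v → ∑ w, ∑ a, T G p u w * T G p w a * T G p a v ≤ b) :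
    Ω * M G x p (fun n => n) ^ 2 * (1 - b) ≤ (1 - p) * M' G x p (fun n => n) := by
  unfold M'
  rw [russo (fun n => (n : ℝ))]
  set χ := M G x p (fun n => (n:ℝ)) with hχ
  have hχ0 : 0 ≤ χ := M_nonneg h0 h1 x fun n _ => Nat.cast_nonneg n
  have hχy : ∀ y, ∑ z, T G p y z = χ := fun y => by
    rw [sum_T]; exact Ex_card_eq hT p (fun n => (n:ℝ)) y x
  have hb : ∀ u v, χ * (T G p x u - ∑ a, ∑ w, T G p x w * (T G p w u * T G p w a * T G p v a)) ≤
      Ex p (inc (G := G) (fun n => (n:ℝ)) x u v) := by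
    intro u v
    have e1 : ∀ ω : G.edgeSet → Bool, ind (u ∈ Cl ω x) * (χ - χ * ∑ a, ind (a ∈ Cl ω x) * T G p v a) ≤
        ind (v ∉ Cl ω x) * (ind (u ∈ Cl ω x) * Ex p (fun ω' : G.edgeSet → Bool => ((ClO ω' (Cl ω x) v).card : ℝ))) := by
      intro ω
      have hcomm : ∀ z : ℝ, ind (v ∉ Cl ω x) * (ind (u ∈ Cl ω x) * z) = ind (u ∈ Cl ω x) * (ind (v ∉ Cl ω x) * z) := by
        intro z; ring
      rw [hcomm]
      refine mul_le_mul_of_nonneg_left ?_ (ind_nonneg _)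
      by_cases hv : v ∈ Cl ω x
      · rw [ind_false (not_not.2 hv), zero_mul]
        have : 1 ≤ ∑ a, ind (a ∈ Cl ω x) * T G p v a := by
          have := Finset.single_le_sum (f := fun a => ind (a ∈ Cl ω x) * T G p v a)
            (fun a _ => mul_nonneg (ind_nonneg _) (T_nonneg h0 h1 _ _)) (Finset.mem_univ v)
          simpa only [ind_true hv, T_self, mul_one] using this
        nlinarith
      · rw [ind_true hv, one_mul]
        simp only [card_eq_sum]
        rw [Ex_sum]
        refine le_trans ?_ (Finset.sum_le_sum fun y _ => through_bound h0 h1 (Cl ω x) v y)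
        rw [Finset.sum_sub_distrib, hχy, Finset.sum_comm]
        apply le_of_eq
        congr 1
        rw [Finset.mul_sum]
        refine Finset.sum_congr rfl fun a _ => ?_
        rw [← hχy a, Finset.sum_mul]
        refine Finset.sum_congr rfl fun y _ => by ring
    have e2 : Ex p (inc (G := G) (fun n => (n:ℝ)) x u v) = Ex p (fun ω : G.edgeSet → Bool =>
        ind (v ∉ Cl ω x) * (ind (u ∈ Cl ω x) * Ex p (fun ω' : G.edgeSet → Bool => ((ClO ω' (Cl ω x) v).card : ℝ)))) := by
      unfold inc
      rw [decouple p x v (fun A B => ind (u ∈ A) * (((A.card + B.card : ℕ) : ℝ) - (A.card : ℝ)))]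
      congr 1; funext ω
      rw [Ex_const_mul]
      congr 2
      congr 1; funext ω'
      push_cast; ring
    rw [e2]
    refine le_trans ?_ (Ex_mono h0 h1 e1)
    have e3 : Ex p (fun ω : G.edgeSet → Bool => ind (u ∈ Cl ω x) * (χ - χ * ∑ a, ind (a ∈ Cl ω x) * T G p v a)) =
        χ * (T G p x u - ∑ a, Ex p (fun ω : G.edgeSet → Bool => ind (u ∈ Cl ω x) * ind (a ∈ Cl ω x)) * T G p v a) := by
      unfold T
      simp only [← Ex_mul_const]
      rw [← Ex_sum, ← Ex_sub, ← Ex_const_mul]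
      congr 1; funext ω
      rw [mul_sub, mul_sub, Finset.mul_sum, Finset.mul_sum, Finset.mul_sum]
      congr 1
      · ring
      · exact Finset.sum_congr rfl fun a _ => by ring
    rw [e3]
    refine mul_le_mul_of_nonneg_left ?_ hχ0
    refine sub_le_sub_left ?_ _
    refine Finset.sum_le_sum fun a _ => ?_
    refine (mul_le_mul_of_nonneg_right (tree_graph h0 h1 x u a) (T_nonneg h0 h1 v a)).trans (le_of_eq ?_)
    rw [Finset.sum_mul]
    exact Finset.sum_congr rfl fun w _ => by ring
  have h4 : ∑ u, ∑ v, (if G.Adj u v then χ * (T G p x u - ∑ a, ∑ w, T G p x w * (T G p w u * T G p w a * T G p v a)) else 0) ≤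
      ∑ u, ∑ v, if G.Adj u v then Ex p (inc (G := G) (fun n => (n:ℝ)) x u v) else 0 := by
    refine Finset.sum_le_sum fun u _ => Finset.sum_le_sum fun v _ => ?_
    split_ifs
    · exact hb u v
    · exact le_rfl
  refine le_trans ?_ h4
  -- the error term
  set Q : V → ℝ := fun w => ∑ u, ∑ v, if G.Adj u v then ∑ a, T G p w u * T G p w a * T G p v a else 0 with hQ
  have hQc : ∀ w, Q w = Q x := by
    intro w
    obtain ⟨φ, rfl⟩ := hT x w
    simp only [hQ]
    rw [← φ.toEquiv.sum_comp]
    refine Finset.sum_congr rfl fun u _ => ?_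
    rw [← φ.toEquiv.sum_comp]
    refine Finset.sum_congr rfl fun v _ => ?_
    have hadj : G.Adj (φ.toEquiv u) (φ.toEquiv v) ↔ G.Adj u v := φ.map_adj_iff
    simp only [hadj]
    congr 1
    rw [← φ.toEquiv.sum_comp]
    refine Finset.sum_congr rfl fun a _ => ?_
    show T G p (φ x) (φ u) * T G p (φ x) (φ a) * T G p (φ v) (φ a) = _
    rw [T_aut, T_aut, T_aut]
  have hQs : ∑ w, Q w = ∑ u, ∑ v, if G.Adj u v then ∑ w, ∑ a, T G p u w * T G p w a * T G p a v else 0 := by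
    simp only [hQ]
    rw [Finset.sum_comm]
    refine Finset.sum_congr rfl fun u _ => ?_
    rw [Finset.sum_comm]
    refine Finset.sum_congr rfl fun v _ => ?_
    split_ifs
    · refine Finset.sum_congr rfl fun w _ => Finset.sum_congr rfl fun a _ => ?_
      rw [T_symm p w u, T_symm p v a]
    · simp
  have hcard : (0:ℝ) < Fintype.card V := by exact_mod_cast Fintype.card_pos_iff.2 ⟨x⟩
  have hQb : Q x ≤ Ω * b := by
    have e1 : ∑ w, Q w = Fintype.card V * Q x := by simp [hQc]
    have e2 : ∑ w, Q w ≤ Ω * (Fintype.card V * b) := by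
      rw [hQs]
      have : ∑ u : V, (fun _ => b) u = Fintype.card V * b := by simp
      rw [← this, ← sum_adj hΩ (fun _ => b)]
      refine Finset.sum_le_sum fun u _ => Finset.sum_le_sum fun v _ => ?_
      split_ifs with h
      · exact htri u v h
      · exact le_rfl
    rw [e1] at e2
    by_contra hcon
    push Not at hcon
    have := mul_lt_mul_of_pos_left hcon hcard
    linarith
  have e5 : ∑ u, ∑ v, (if G.Adj u v then χ * (T G p x u - ∑ a, ∑ w, T G p x w * (T G p w u * T G p w a * T G p v a)) else 0)
      = χ * (Ω * χ) - χ * ∑ w, T G p x w * Q w := by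
    have a1 : χ * (Ω * χ) = ∑ u, ∑ v, (if G.Adj u v then χ * T G p x u else 0) := by
      rw [sum_adj hΩ (fun u => χ * T G p x u), ← Finset.mul_sum, hχy]; ring
    have a2 : χ * ∑ w, T G p x w * Q w = ∑ u, ∑ v, (if G.Adj u v then χ * ∑ a, ∑ w, T G p x w * (T G p w u * T G p w a * T G p v a) else 0) := by
      simp only [hQ, Finset.mul_sum]
      rw [Finset.sum_comm]
      refine Finset.sum_congr rfl fun u _ => ?_
      rw [Finset.sum_comm]
      refine Finset.sum_congr rfl fun v _ => ?_
      split_ifs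
      · rw [Finset.sum_comm]
        simp only [Finset.mul_sum]
      · simp
    rw [a1, a2, ← Finset.sum_sub_distrib]
    refine Finset.sum_congr rfl fun u _ => ?_
    rw [← Finset.sum_sub_distrib]
    refine Finset.sum_congr rfl fun v _ => ?_
    split_ifs <;> ring
  rw [e5]
  have e6 : ∑ w, T G p x w * Q w = χ * Q x := by
    rw [← hχy x, Finset.sum_mul]
    exact Finset.sum_congr rfl fun w _ => by rw [hQc w]
  rw [e6]
  have := mul_le_mul_of_nonneg_left hQb (mul_nonneg hχ0 hχ0)
  nlinarith

end diffineq
end PW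

set_option linter.unusedSectionVars false
set_option linter.unusedVariables false

namespace PW
open Percolation

section score
variable {V : Type} [Fintype V] {G : SimpleGraph V}

/-- the bond touches the cluster of x -/
def tch (x : V) (e : G.edgeSet) (ω : G.edgeSet → Bool) : Prop := e ∉ off G (Cl ω x)

lemma cl_untouched {x : V} {e : G.edgeSet} {ω : G.edgeSet → Bool} (h : ¬ tch x e ω) (b : Bool) :
    Cl (upd ω e b) x = Cl ω x := by
  refine cl_dep (ω := ω) ?_ rfl
  intro e' he'
  have : e' ≠ e := fun hh => h (hh ▸ he')
  simp [upd, this]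

lemma tch_upd (x : V) (e : G.edgeSet) (ω : G.edgeSet → Bool) (b : Bool) : tch x e (upd ω e b) ↔ tch x e ω := by
  have key : ∀ (ω : G.edgeSet → Bool) (b : Bool), ¬ tch x e ω → ¬ tch x e (upd ω e b) := by
    intro ω b h
    have := cl_untouched h b
    unfold tch at *
    rwa [this]
  constructor
  · intro h; by_contra h'; exact key ω b h' h
  · intro h; by_contra h'
    have := key (upd ω e b) (ω e) h'
    simp [upd] at this
    exact this h

lemma tch_inc (x : V) (e : G.edgeSet) : Inc (tch (G := G) x e) := by
  intro ω ω' h ht hn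
  exact ht fun a ha => hn a (cl_mono h x ha)

/-- centered bond variable -/
def sc (p : ℝ) (e : G.edgeSet) (ω : G.edgeSet → Bool) : ℝ := (if ω e then 1 else 0) - p

lemma score_deriv (p : ℝ) (x : V) (f : ℕ → ℝ) :
    p * (1 - p) * M' G x p f =
      Ex p (fun ω : G.edgeSet → Bool => f (Cl ω x).card * ∑ e, ind (tch x e ω) * sc p e ω) := by
  unfold M'
  simp only [Finset.mul_sum]
  rw [Ex_sum]
  refine Finset.sum_congr rfl fun e _ => ?_
  rw [Ex_coord p e (fun ω : G.edgeSet → Bool => f (Cl ω x).card * (ind (tch x e ω) * sc p e ω)), ← Ex_const_mul]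
  congr 1
  funext ω
  rw [ind_congr (tch_upd x e ω true), ind_congr (tch_upd x e ω false)]
  have a1 : sc p e (upd ω e true) = 1 - p := by simp [sc, upd]
  have a2 : sc p e (upd ω e false) = - p := by simp [sc, upd]
  rw [a1, a2, dif]
  by_cases h : tch x e ω
  · rw [ind_true h]
    ring
  · rw [ind_false h, cl_untouched h, cl_untouched h]
    ring

lemma upd_comm {e e' : G.edgeSet} (h : e ≠ e') (ω : G.edgeSet → Bool) (b b' : Bool) :
    upd (upd ω e b) e' b' = upd (upd ω e' b') e b := by
  funext c
  by_cases h1 : c = e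
  · subst h1; simp [upd, h]
  · by_cases h2 : c = e'
    · subst h2; simp [upd, h1]
    · simp [upd, h1, h2]

lemma score_cross (p : ℝ) (x : V) {e e' : G.edgeSet} (h : e ≠ e') :
    Ex p (fun ω : G.edgeSet → Bool => (ind (tch x e ω) * sc p e ω) * (ind (tch x e' ω) * sc p e' ω)) = 0 := by
  have hs : ∀ (ω : G.edgeSet → Bool) b, sc p e' (upd ω e b) = sc p e' ω := by
    intro ω b; simp [sc, upd, h.symm]
  rw [Ex_coord p e]
  have h1 : (fun ω : G.edgeSet → Bool => p * ((ind (tch x e (upd ω e true)) * sc p e (upd ω e true)) *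
      (ind (tch x e' (upd ω e true)) * sc p e' (upd ω e true))) + (1 - p) *
      ((ind (tch x e (upd ω e false)) * sc p e (upd ω e false)) *
      (ind (tch x e' (upd ω e false)) * sc p e' (upd ω e false)))) =
      fun ω => p * (1 - p) * (ind (tch x e ω) * sc p e' ω *
        (ind (tch x e' (upd ω e true)) - ind (tch x e' (upd ω e false)))) := by
    funext ω
    rw [ind_congr (tch_upd x e ω true), ind_congr (tch_upd x e ω false), hs, hs]
    have a1 : sc p e (upd ω e true) = 1 - p := by simp [sc, upd]
    have a2 : sc p e (upd ω e false) = - p := by simp [sc, upd]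
    rw [a1, a2]; ring
  rw [h1, Ex_const_mul, Ex_coord p e']
  have h2 : (fun ω : G.edgeSet → Bool => p * (ind (tch x e (upd ω e' true)) * sc p e' (upd ω e' true) *
        (ind (tch x e' (upd (upd ω e' true) e true)) - ind (tch x e' (upd (upd ω e' true) e false)))) + (1 - p) *
        (ind (tch x e (upd ω e' false)) * sc p e' (upd ω e' false) *
        (ind (tch x e' (upd (upd ω e' false) e true)) - ind (tch x e' (upd (upd ω e' false) e false))))) =
      fun ω => 0 := by
    funext ω
    have a1 : sc p e' (upd ω e' true) = 1 - p := by simp [sc, upd]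
    have a2 : sc p e' (upd ω e' false) = - p := by simp [sc, upd]
    have a3 : ∀ b b', ind (tch x e' (upd (upd ω e' b') e b)) = ind (tch x e' (upd (upd ω e' false) e b)) := by
      intro b b'
      rw [upd_comm h.symm, upd_comm h.symm ω false b]
      rw [ind_congr (tch_upd x e' _ _), ind_congr (tch_upd x e' _ _)]
    rw [a1, a2, a3 true true, a3 false true]
    by_cases ht : tch x e (upd ω e' false)
    · have ht' : tch x e (upd ω e' true) := by
        refine tch_inc x e _ _ ?_ ht
        have := upd_true_ge (upd ω e' false) e'
        simpa [upd] using this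
      rw [ind_true ht, ind_true ht']; ring
    · have : ∀ b, ind (tch x e' (upd (upd ω e' false) e b)) = ind (tch x e' (upd ω e' false)) := by
        intro b
        unfold tch
        rw [cl_untouched ht b]
      rw [this, this]; ring
  rw [h2]
  simp [Ex_const]

lemma score_diag (p : ℝ) (x : V) (e : G.edgeSet) :
    Ex p (fun ω : G.edgeSet → Bool => (ind (tch x e ω) * sc p e ω) * (ind (tch x e ω) * sc p e ω)) =
      p * (1 - p) * Ex p (fun ω : G.edgeSet → Bool => ind (tch x e ω)) := by
  rw [Ex_coord p e, ← Ex_const_mul]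
  congr 1
  funext ω
  rw [ind_congr (tch_upd x e ω true), ind_congr (tch_upd x e ω false)]
  have a1 : sc p e (upd ω e true) = 1 - p := by simp [sc, upd]
  have a2 : sc p e (upd ω e false) = - p := by simp [sc, upd]
  rw [a1, a2]
  by_cases h : tch x e ω
  · rw [ind_true h]; ring
  · rw [ind_false h]; ring

lemma touched_sum {Ω : ℝ} (hΩ : ∀ u, ∑ v, (if G.Adj u v then (1:ℝ) else 0) = Ω) (x : V) (ω : G.edgeSet → Bool) :
    ∑ e, ind (tch x e ω) ≤ Ω * (Cl ω x).card := by
  have h1 : ∀ e : G.edgeSet, ind (tch x e ω) ≤ ∑ a, ind (a ∈ e.1) * ind (a ∈ Cl ω x) := by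
    intro e
    by_cases h : tch x e ω
    · rw [ind_true h]
      unfold tch off at h
      simp only [Set.mem_ofPred_eq] at h
      push Not at h
      obtain ⟨a, ha, hae⟩ := h
      have := Finset.single_le_sum (f := fun a => ind (a ∈ e.1) * ind (a ∈ Cl ω x))
        (fun a _ => mul_nonneg (ind_nonneg _) (ind_nonneg _)) (Finset.mem_univ a)
      simpa only [ind_true ha, ind_true hae, mul_one] using this
    · rw [ind_false h]
      exact Finset.sum_nonneg fun _ _ => mul_nonneg (ind_nonneg _) (ind_nonneg _)
  refine (Finset.sum_le_sum fun e _ => h1 e).trans (le_of_eq ?_)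
  rw [sum_edges (fun e : G.edgeSet => ∑ a, ind (a ∈ e.1) * ind (a ∈ Cl ω x)) (fun u v => ind (u ∈ Cl ω x)),
    sum_adj hΩ (fun u => ind (u ∈ Cl ω x)), ← card_eq_sum]
  intro u v huv
  have h2 : ∀ a, ind (a ∈ s(u,v)) = ind (a = u) + ind (a = v) := by
    intro a
    by_cases hu : a = u
    · subst hu
      simp [ind, huv.ne]
    · by_cases hv : a = v
      · subst hv; simp [ind, hu]
      · simp [ind, hu, hv]
  simp only [h2, add_mul, Finset.sum_add_distrib]
  have h3 : ∀ c, ∑ a, ind (a = c) * ind (a ∈ Cl ω x) = ind (c ∈ Cl ω x) := by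
    intro c
    rw [Finset.sum_eq_single c]
    · rw [ind_true rfl, one_mul]
    · intro b _ hb; rw [ind_false hb, zero_mul]
    · simp
  rw [h3, h3]

theorem score_bound {Ω : ℝ} (hΩ : ∀ u, ∑ v, (if G.Adj u v then (1:ℝ) else 0) = Ω) {p : ℝ} (h0 : 0 < p) (h1 : p < 1)
    (x : V) (f : ℕ → ℝ) :
    p * (1 - p) * M' G x p f ^ 2 ≤ M G x p (fun n => f n ^ 2) * (Ω * M G x p (fun n => n)) := by
  have hpp : 0 < p * (1 - p) := mul_pos h0 (by linarith)
  have hX2 : Ex p (fun ω : G.edgeSet → Bool => (∑ e, ind (tch x e ω) * sc p e ω) ^ 2) ≤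
      p * (1 - p) * (Ω * M G x p (fun n => n)) := by
    have e1 : Ex p (fun ω : G.edgeSet → Bool => (∑ e, ind (tch x e ω) * sc p e ω) ^ 2) =
        ∑ e, p * (1 - p) * Ex p (fun ω : G.edgeSet → Bool => ind (tch x e ω)) := by
      simp only [sq, Finset.sum_mul_sum]
      rw [Ex_sum]
      refine Finset.sum_congr rfl fun e _ => ?_
      rw [Ex_sum, Finset.sum_eq_single e]
      · exact score_diag p x e
      · intro e' _ hne; exact score_cross p x hne.symm
      · simp
    rw [e1, ← Finset.mul_sum]
    refine mul_le_mul_of_nonneg_left ?_ hpp.le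
    rw [← Ex_sum]
    unfold M
    rw [← Ex_const_mul]
    exact Ex_mono h0.le h1.le fun ω => touched_sum hΩ x ω
  have hc := Ex_cauchy h0.le h1.le (fun ω : G.edgeSet → Bool => f (Cl ω x).card)
    (fun ω => ∑ e, ind (tch x e ω) * sc p e ω)
  rw [← score_deriv] at hc
  have hf2 : 0 ≤ M G x p (fun n => f n ^ 2) := M_nonneg h0.le h1.le x fun n _ => sq_nonneg _
  have hc' : (p * (1 - p) * M' G x p f) ^ 2 ≤ M G x p (fun n => f n ^ 2) * (p * (1 - p) * (Ω * M G x p (fun n => n))) :=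
    hc.trans (mul_le_mul_of_nonneg_left hX2 hf2)
  have : p * (1 - p) * (p * (1 - p) * M' G x p f ^ 2) ≤
      p * (1 - p) * (M G x p (fun n => f n ^ 2) * (Ω * M G x p (fun n => n))) := by nlinarith
  exact le_of_mul_le_mul_left this hpp

end score
end PW

set_option linter.unusedSectionVars false
set_option linter.unusedVariables false

namespace PW
open Percolation

lemma riccati_lower {g g' : ℝ → ℝ} {a b c : ℝ} (hab : a ≤ b) (hg : ∀ t, HasDerivAt g (g' t) t)
    (hpos : ∀ t ∈ Set.Icc a b, 0 < g t) (hd : ∀ t ∈ Set.Icc a b, c * g t ^ 2 ≤ g' t) :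
    c * (b - a) ≤ (g a)⁻¹ - (g b)⁻¹ := by
  have hanti : AntitoneOn (fun t => (g t)⁻¹ + c * t) (Set.Icc a b) := by
    have hD : ∀ t ∈ Set.Icc a b, HasDerivAt (fun t => (g t)⁻¹ + c * t) (-(g' t) / g t ^ 2 + c * 1) t := by
      intro t ht
      exact ((hg t).fun_inv (hpos t ht).ne').add ((hasDerivAt_id t).const_mul c)
    refine antitoneOn_of_deriv_nonpos (convex_Icc a b) ?_ ?_ ?_
    · intro t ht; exact (hD t ht).continuousAt.continuousWithinAt
    · intro t ht; exact (hD t (interior_subset ht)).differentiableAt.differentiableWithinAt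
    · intro t ht
      rw [(hD t (interior_subset ht)).deriv]
      have h1 := hd t (interior_subset ht)
      have h2 := hpos t (interior_subset ht)
      have : c ≤ g' t / g t ^ 2 := by rw [le_div_iff₀ (by positivity)]; exact h1
      rw [neg_div]; linarith
  have := hanti (Set.left_mem_Icc.2 hab) (Set.right_mem_Icc.2 hab) hab
  simp only at this
  linarith

lemma riccati_upper {g g' : ℝ → ℝ} {a b c : ℝ} (hab : a ≤ b) (hg : ∀ t, HasDerivAt g (g' t) t)
    (hpos : ∀ t ∈ Set.Icc a b, 0 < g t) (hd : ∀ t ∈ Set.Icc a b, g' t ≤ c * g t ^ 2) :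
    (g a)⁻¹ - (g b)⁻¹ ≤ c * (b - a) := by
  have hanti : MonotoneOn (fun t => (g t)⁻¹ + c * t) (Set.Icc a b) := by
    have hD : ∀ t ∈ Set.Icc a b, HasDerivAt (fun t => (g t)⁻¹ + c * t) (-(g' t) / g t ^ 2 + c * 1) t := by
      intro t ht
      exact ((hg t).fun_inv (hpos t ht).ne').add ((hasDerivAt_id t).const_mul c)
    refine monotoneOn_of_deriv_nonneg (convex_Icc a b) ?_ ?_ ?_
    · intro t ht; exact (hD t ht).continuousAt.continuousWithinAt
    · intro t ht; exact (hD t (interior_subset ht)).differentiableAt.differentiableWithinAt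
    · intro t ht
      rw [(hD t (interior_subset ht)).deriv]
      have h1 := hd t (interior_subset ht)
      have h2 := hpos t (interior_subset ht)
      have : g' t / g t ^ 2 ≤ c := by rw [div_le_iff₀ (by positivity)]; exact h1
      rw [neg_div]; linarith
  have := hanti (Set.left_mem_Icc.2 hab) (Set.right_mem_Icc.2 hab) hab
  simp only at this
  linarith

section ctx
variable {V : Type} [Fintype V] {G : SimpleGraph V}

/-- standing assumptions -/
structure Ctx (G : SimpleGraph V) (Ω pc : ℝ) : Prop where
  hT : IsTransitive G
  hΩ : ∀ u, ∑ v, (if G.Adj u v then (1:ℝ) else 0) = Ω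
  hΩ0 : 0 < Ω
  pc0 : 0 < pc
  pc1 : pc < 1
  tri : ∀ u v, G.Adj u v → ∑ w, ∑ a, T G pc u w * T G pc w a * T G pc a v ≤ 1 / 100

/-- susceptibility -/
abbrev X (G : SimpleGraph V) (x : V) (p : ℝ) : ℝ := M G x p (fun n => (n : ℝ))

lemma T_mono_p {p q : ℝ} (h0 : 0 ≤ p) (h : p ≤ q) (h1 : q ≤ 1) (x y : V) : T G p x y ≤ T G q x y :=
  Ex_monotone_p (conn_inc x y).ind_mono h0 h h1

lemma M_mono_p {p q : ℝ} (h0 : 0 ≤ p) (h : p ≤ q) (h1 : q ≤ 1) (x : V) {f : ℕ → ℝ} (hf : Monotone f) :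
    M G x p f ≤ M G x q f := by
  refine Ex_monotone_p ?_ h0 h h1
  intro ω ω' hω
  exact hf (Finset.card_le_card (cl_mono hω x))

lemma X_mono_p {p q : ℝ} (h0 : 0 ≤ p) (h : p ≤ q) (h1 : q ≤ 1) (x : V) : X G x p ≤ X G x q :=
  M_mono_p h0 h h1 x Nat.mono_cast

lemma one_le_X {p : ℝ} (h0 : 0 ≤ p) (h1 : p ≤ 1) (x : V) : 1 ≤ X G x p := by
  have := M_mono (G := G) h0 h1 x (f := fun _ => 1) (g := fun n => (n:ℝ)) (fun n hn => by exact_mod_cast hn)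
  rwa [M_const] at this

lemma Ex_zero {E : Type*} [Fintype E] (f : (E → Bool) → ℝ) : Ex 0 f = f (fun _ => false) := by
  unfold Ex
  rw [Finset.sum_eq_single (fun _ => false)]
  · simp [wt]
  · intro ω _ hω
    obtain ⟨e, he⟩ := Function.ne_iff.1 hω
    have : wt 0 ω = 0 := by
      unfold wt
      refine Finset.prod_eq_zero (Finset.mem_univ e) ?_
      simp at he
      simp [he]
    rw [this, zero_mul]
  · simp

lemma X_zero (x : V) : X G x 0 = 1 := by
  unfold X M
  rw [Ex_zero]
  have : Cl (fun _ : G.edgeSet => false) x = {x} := by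
    ext y
    constructor
    · intro hy
      have := cl_closed (A := {x}) (by simp) ?_ hy
      · simpa using this
      · intro a _ b hab
        obtain ⟨_, h⟩ := (occ_adj _ _ _).1 hab
        simp at h
    · intro hy; rw [Finset.mem_singleton] at hy; subst hy; exact self_mem_cl _ _
  rw [this]; simp

namespace Ctx

lemma pc_le {Ω pc : ℝ} (C : Ctx G Ω pc) (x : V) : pc ≤ 1 / 100 := by
  have : ∃ v, G.Adj x v := by
    by_contra h
    push Not at h
    have h1 := C.hΩ x
    simp [h] at h1
    have := C.hΩ0
    linarith
  obtain ⟨v, hv⟩ := this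
  have hT0 := fun a b : V => T_nonneg (G := G) C.pc0.le C.pc1.le a b
  have h1 : T G pc x v ≤ 1 / 100 := by
    refine le_trans ?_ (C.tri x v hv)
    have a1 := Finset.single_le_sum (f := fun w => ∑ a, T G pc x w * T G pc w a * T G pc a v)
      (fun w _ => Finset.sum_nonneg fun a _ => mul_nonneg (mul_nonneg (hT0 _ _) (hT0 _ _)) (hT0 _ _)) (Finset.mem_univ x)
    have a2 := Finset.single_le_sum (f := fun a => T G pc x x * T G pc x a * T G pc a v)
      (fun a _ => mul_nonneg (mul_nonneg (hT0 _ _) (hT0 _ _)) (hT0 _ _)) (Finset.mem_univ x)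
    simp only [T_self, one_mul] at a1 a2
    exact a2.trans a1
  refine le_trans ?_ h1
  unfold T
  rw [Ex_coord pc ⟨s(x,v), hv⟩]
  have : pc = Ex pc (fun ω : G.edgeSet → Bool => pc) := (Ex_const _ _).symm
  conv_lhs => rw [this]
  refine Ex_mono C.pc0.le C.pc1.le fun ω => ?_
  rw [ind_true (cl_step (self_mem_cl _ _) (oa_upd_self ω hv))]
  have := mul_nonneg (sub_nonneg.2 C.pc1.le) (ind_nonneg (v ∈ Cl (upd ω ⟨s(x,v), hv⟩ false) x))
  linarith

lemma tri_le {Ω pc : ℝ} (C : Ctx G Ω pc) {p : ℝ} (h0 : 0 ≤ p) (h : p ≤ pc) (u v : V) (huv : G.Adj u v) :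
    ∑ w, ∑ a, T G p u w * T G p w a * T G p a v ≤ 1 / 100 := by
  refine le_trans ?_ (C.tri u v huv)
  have hT0 := fun a b : V => T_nonneg (G := G) h0 (h.trans C.pc1.le) a b
  have hT0' := fun a b : V => T_nonneg (G := G) C.pc0.le C.pc1.le a b
  have hm := fun a b : V => T_mono_p (G := G) h0 h C.pc1.le a b
  refine Finset.sum_le_sum fun w _ => Finset.sum_le_sum fun a _ => ?_
  exact mul_le_mul (mul_le_mul (hm _ _) (hm _ _) (hT0 _ _) (hT0' _ _)) (hm _ _) (hT0 _ _)
    (mul_nonneg (hT0' _ _) (hT0' _ _))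

lemma lower {Ω pc : ℝ} (C : Ctx G Ω pc) {p : ℝ} (h0 : 0 ≤ p) (h : p ≤ pc) (x : V) :
    (99/100) * Ω * X G x p ^ 2 ≤ M' G x p (fun n => (n:ℝ)) := by
  have h1 := lower_diff C.hT C.hΩ h0 (h.trans C.pc1.le) x (C.tri_le h0 h)
  have h2 : 0 ≤ Ω * X G x p ^ 2 := mul_nonneg C.hΩ0.le (sq_nonneg _)
  have hp1 : 0 < 1 - p := by linarith [C.pc1]
  have h3 : 0 ≤ M' G x p (fun n => (n:ℝ)) := by
    by_contra hc
    push Not at hc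
    have := mul_neg_of_pos_of_neg hp1 hc
    have : 0 ≤ Ω * X G x p ^ 2 * (1 - 1/100) := by positivity
    linarith
  have : (1 - p) * M' G x p (fun n => (n:ℝ)) ≤ M' G x p (fun n => (n:ℝ)) := by nlinarith
  unfold X at *
  linarith

lemma lower_int {Ω pc : ℝ} (C : Ctx G Ω pc) {p r : ℝ} (h0 : 0 ≤ p) (hpr : p ≤ r) (h : r ≤ pc) (x : V) :
    (99/100) * Ω * (r - p) ≤ (X G x p)⁻¹ - (X G x r)⁻¹ := by
  refine riccati_lower hpr (fun t => hasDerivAt_M (G := G) x (fun n => (n:ℝ)) t) ?_ ?_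
  · intro t ht
    exact lt_of_lt_of_le one_pos (one_le_X (h0.trans ht.1) (ht.2.trans (h.trans C.pc1.le)) x)
  · intro t ht
    exact C.lower (h0.trans ht.1) (ht.2.trans h) x

/-- differential inequality for functions with the truncation structure -/
lemma upper {Ω pc : ℝ} (C : Ctx G Ω pc) {p : ℝ} (h0 : 0 ≤ p) (h1 : p ≤ 1/50) (x : V) (f : ℕ → ℝ) (hf : Monotone f) (hf0 : ∀ n, 0 ≤ f n)
    (g : ℕ → ℝ) (hg0 : ∀ n, 0 ≤ g n) (hfg : ∀ a b, f (a + b) - f a ≤ g a * f b) (hgf : ∀ n : ℕ, n * g n ≤ f n) :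
    M' G x p f ≤ (50/49) * Ω * M G x p f ^ 2 := by
  have hu := upper_diff C.hT C.hΩ h0 (h1.trans (by norm_num)) x f g f (fun _ => 0) (fun _ => 0)
    (fun a b => by have := hfg a b; linarith) hg0 (fun _ => le_rfl) hf (fun _ _ _ => le_rfl) hf0 (fun _ => le_rfl)
  have hz : M G x p (fun n => (n:ℝ) * 0) = 0 := by simp [M_const]
  rw [hz, zero_mul, add_zero] at hu
  have hM0 : 0 ≤ M G x p f := M_nonneg h0 (h1.trans (by norm_num)) x fun n _ => hf0 n
  have h2 : M G x p (fun n => n * g n) ≤ M G x p f := M_mono h0 (h1.trans (by norm_num)) x fun n _ => hgf n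
  have h3 : (1 - p) * M' G x p f ≤ Ω * M G x p f ^ 2 := by
    refine hu.trans ?_
    rw [sq]
    exact mul_le_mul_of_nonneg_left (mul_le_mul_of_nonneg_right h2 hM0) C.hΩ0.le
  have h4 : 0 ≤ Ω * M G x p f ^ 2 := mul_nonneg C.hΩ0.le (sq_nonneg _)
  by_cases h5 : M' G x p f ≤ 0
  · nlinarith
  · push Not at h5
    nlinarith

lemma upper_int {Ω pc : ℝ} (C : Ctx G Ω pc) {p r : ℝ} (h0 : 0 ≤ p) (hpr : p ≤ r) (h1 : r ≤ 1/50) (x : V) (f : ℕ → ℝ) (hf : Monotone f)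
    (hf1 : ∀ n, 1 ≤ n → 1 ≤ f n) (hf0 : ∀ n, 0 ≤ f n)
    (g : ℕ → ℝ) (hg0 : ∀ n, 0 ≤ g n) (hfg : ∀ a b, f (a + b) - f a ≤ g a * f b) (hgf : ∀ n : ℕ, n * g n ≤ f n) :
    (M G x p f)⁻¹ - (M G x r f)⁻¹ ≤ (50/49) * Ω * (r - p) := by
  refine riccati_upper hpr (fun t => hasDerivAt_M (G := G) x f t) ?_ ?_
  · intro t ht
    have ht1 : t ≤ 1 := ht.2.trans (h1.trans (by norm_num))
    have := M_mono (G := G) (h0.trans ht.1) ht1 x (f := fun _ => 1) (g := f) hf1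
    rw [M_const] at this
    linarith
  · intro t ht
    exact C.upper (h0.trans ht.1) (ht.2.trans h1) x f hf hf0 g hg0 hfg hgf

lemma upper_int_id {Ω pc : ℝ} (C : Ctx G Ω pc) {p r : ℝ} (h0 : 0 ≤ p) (hpr : p ≤ r) (h1 : r ≤ 1/50) (x : V) :
    (X G x p)⁻¹ - (X G x r)⁻¹ ≤ (50/49) * Ω * (r - p) :=
  C.upper_int h0 hpr h1 x (fun n => (n:ℝ)) Nat.mono_cast (fun n hn => by exact_mod_cast hn) (fun n => Nat.cast_nonneg n)
    (fun _ => 1) (fun _ => zero_le_one) (fun a b => by push_cast; linarith) (fun n => by simp)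

lemma upper_int_min {Ω pc : ℝ} (C : Ctx G Ω pc) {p r k : ℝ} (hk : 1 ≤ k) (h0 : 0 ≤ p) (hpr : p ≤ r) (h1 : r ≤ 1/50) (x : V) :
    (M G x p (fun n => min (n:ℝ) k))⁻¹ - (M G x r (fun n => min (n:ℝ) k))⁻¹ ≤ (50/49) * Ω * (r - p) := by
  refine C.upper_int h0 hpr h1 x (fun n => min (n:ℝ) k) ?_ ?_ ?_ (fun n => ind ((n:ℝ) < k)) (fun n => ind_nonneg _) ?_ ?_
  · intro a b hab
    exact min_le_min_right k (by exact_mod_cast hab)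
  · intro n hn
    exact le_min (by exact_mod_cast hn) hk
  · intro n
    exact le_min (Nat.cast_nonneg n) (by linarith)
  · intro a b
    push_cast
    have ha : (0:ℝ) ≤ a := Nat.cast_nonneg a
    have hb : (0:ℝ) ≤ b := Nat.cast_nonneg b
    by_cases h : (a:ℝ) < k
    · rw [ind_true h, one_mul, min_eq_left h.le]
      rcases le_total (b:ℝ) k with h' | h'
      · rw [min_eq_left h']; linarith [min_le_left ((a:ℝ)+b) k]
      · rw [min_eq_right h']; linarith [min_le_right ((a:ℝ)+b) k]
    · push Not at h
      rw [ind_false (not_lt.2 h), zero_mul, min_eq_right h]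
      linarith [min_le_right ((a:ℝ)+b) k]
  · intro n
    have hn : (0:ℝ) ≤ n := Nat.cast_nonneg n
    by_cases h : (n:ℝ) < k
    · rw [ind_true h, mul_one, min_eq_left h.le]
    · rw [ind_false h, mul_zero]
      exact le_min hn (by linarith)

lemma omega_p {Ω pc : ℝ} (C : Ctx G Ω pc) {p : ℝ} (h0 : 0 ≤ p) (h : p ≤ pc) (x : V) (hX : 4 ≤ X G x p) : 7/10 ≤ Ω * p := by
  have h1 := C.upper_int_id le_rfl h0 (by linarith [C.pc_le x]) x
  rw [X_zero] at h1
  have : (X G x p)⁻¹ ≤ 4⁻¹ := inv_anti₀ (by norm_num) hX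
  norm_num at h1 this
  nlinarith

/-- a positive fraction of the susceptibility comes from clusters of size of order χ² -/
theorem lemL {Ω pc : ℝ} (C : Ctx G Ω pc) {p : ℝ} (h0 : 0 ≤ p) (h : p ≤ pc) (x : V) (hX : 4 ≤ X G x p) :
    X G x p / 4 ≤ M G x p (fun n => n * ind (X G x p ^ 2 / 128 ≤ n)) := by
  have hΩp := C.omega_p h0 h x hX
  have hpc := C.pc_le x
  have hΩ0 := C.hΩ0
  have hp0 : 0 < p := by
    rcases h0.lt_or_eq with h' | h'
    · exact h'
    · rw [← h'] at hΩp; norm_num at hΩp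
  have hp1 : p < 1 := by linarith
  set χ := X G x p with hχ
  set k := χ ^ 2 / 64 with hk
  have hk0 : 0 < k := by positivity
  have hlow := C.lower h0 h x
  -- score
  have hs := score_bound C.hΩ hp0 hp1 x (fun n => min (n:ℝ) k)
  have hf2 : M G x p (fun n => (min (n:ℝ) k) ^ 2) ≤ k * χ := by
    rw [hχ, ← M_const_mul]
    refine M_mono h0 hp1.le x fun n _ => ?_
    have hn : (0:ℝ) ≤ n := Nat.cast_nonneg n
    rcases le_total (n:ℝ) k with h' | h'
    · rw [min_eq_left h']; nlinarith
    · rw [min_eq_right h']; nlinarith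
  have hM : M' G x p (fun n => min (n:ℝ) k) ≤ Ω * χ ^ 2 / 4 := by
    have e1 : p * (1 - p) * M' G x p (fun n => min (n:ℝ) k) ^ 2 ≤ k * χ * (Ω * χ) :=
      hs.trans (mul_le_mul_of_nonneg_right hf2 (by positivity))
    set m := M' G x p (fun n => min (n:ℝ) k) with hm
    have e2 : Ω * p * (1 - p) * m ^ 2 ≤ Ω ^ 2 * χ ^ 4 / 64 := by
      have := mul_le_mul_of_nonneg_left e1 hΩ0.le
      have e : Ω * (k * χ * (Ω * χ)) = Ω ^ 2 * χ ^ 4 / 64 := by rw [hk]; ring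
      rw [e] at this
      linarith
    have e3 : (1:ℝ)/2 ≤ Ω * p * (1 - p) := by nlinarith
    have e4 : 1/2 * m ^ 2 ≤ Ω ^ 2 * χ ^ 4 / 64 := (mul_le_mul_of_nonneg_right e3 (sq_nonneg m)).trans e2
    have e5 : m ^ 2 ≤ (Ω * χ ^ 2 / 4) ^ 2 := by
      have : 0 ≤ Ω ^ 2 * χ ^ 4 := by positivity
      nlinarith
    exact abs_le_of_sq_le_sq' e5 (by positivity) |>.2
  -- excess
  have hu := upper_diff C.hT C.hΩ h0 hp1.le x (fun n => (n:ℝ) - min (n:ℝ) k)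
    (fun n => ind (χ ^ 2 / 128 ≤ n)) (fun n => (n:ℝ)) (fun _ => 1) (fun n => n * ind (χ ^ 2 / 128 ≤ n)) ?_
    (fun _ => ind_nonneg _) (fun _ => zero_le_one) Nat.mono_cast ?_ (fun n => Nat.cast_nonneg n)
    (fun n => mul_nonneg (Nat.cast_nonneg n) (ind_nonneg _))
  · rw [M'_sub] at hu
    simp only [mul_one] at hu
    have hu' : (1 - p) * (M' G x p (fun n => (n:ℝ)) - M' G x p (fun n => min (n:ℝ) k)) ≤
        2 * Ω * χ * M G x p (fun n => n * ind (χ ^ 2 / 128 ≤ n)) := by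
      refine hu.trans (le_of_eq ?_)
      show Ω * (M G x p (fun n => n * ind (χ ^ 2 / 128 ≤ n)) * χ + χ * M G x p (fun n => n * ind (χ ^ 2 / 128 ≤ n))) = _
      ring
    have hΩχ : 0 ≤ Ω * χ ^ 2 := by positivity
    have e1 : (74/100) * (Ω * χ ^ 2) ≤ M' G x p (fun n => (n:ℝ)) - M' G x p (fun n => min (n:ℝ) k) := by linarith
    have e2 : (99/100) * ((74/100) * (Ω * χ ^ 2)) ≤ (1 - p) * (M' G x p (fun n => (n:ℝ)) - M' G x p (fun n => min (n:ℝ) k)) :=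
      mul_le_mul (by linarith) e1 (by positivity) (by linarith)
    have e3 : 2 * Ω * χ * (χ / 4) ≤ 2 * Ω * χ * M G x p (fun n => n * ind (χ ^ 2 / 128 ≤ n)) := by nlinarith
    exact le_of_mul_le_mul_left e3 (by positivity)
  · intro a b
    push_cast
    have ha : (0:ℝ) ≤ a := Nat.cast_nonneg a
    have hb : (0:ℝ) ≤ b := Nat.cast_nonneg b
    have hmin : min (a:ℝ) k ≤ min ((a:ℝ) + b) k := min_le_min_right k (by linarith)
    by_cases h1 : χ ^ 2 / 128 ≤ (a:ℝ)
    · rw [ind_true h1]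
      have := mul_nonneg hb (ind_nonneg (χ ^ 2 / 128 ≤ (b:ℝ)))
      linarith
    · by_cases h2 : χ ^ 2 / 128 ≤ (b:ℝ)
      · rw [ind_true h2, ind_false h1]; linarith
      · rw [ind_false h1, ind_false h2]
        push Not at h1 h2
        rw [min_eq_left (by rw [hk]; linarith), min_eq_left (by rw [hk]; linarith)]
        linarith
  · intro a b hab
    have hab' : (a:ℝ) ≤ b := by exact_mod_cast hab
    exact mul_le_mul hab' (ind_mono fun h => h.trans hab') (ind_nonneg _) (Nat.cast_nonneg b)

end Ctx
end ctx
end PW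

set_option linter.unusedSectionVars false
set_option linter.unusedVariables false

namespace PW
open Percolation

section window
variable {V : Type} [Fintype V] {G : SimpleGraph V}

lemma one_le_Mmin {p k : ℝ} (h0 : 0 ≤ p) (h1 : p ≤ 1) (hk : 1 ≤ k) (x : V) :
    1 ≤ M G x p (fun n => min (n:ℝ) k) := by
  have := M_mono (G := G) h0 h1 x (f := fun _ => (1:ℝ)) (g := fun n => min (n:ℝ) k)
    (fun n hn => le_min (by exact_mod_cast hn) hk)
  rwa [M_const] at this

theorem Ctx.window {Ω pc : ℝ} (C : Ctx G Ω pc) {lam L s q c : ℝ} (x : V) (hlam : 0 < lam) (hL : 1 ≤ L)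
    (hs : 40 * L ≤ s) (hX : X G x pc = lam * s) (h100 : 100 ≤ lam * s)
    (hc : c = (lam⁻¹ + 21 * L)⁻¹) (hcs : 32 ≤ c * s)
    (hq : pc ≤ q) (hq' : Ω * (q - pc) ≤ L / s) :
    q ≤ 1/50 ∧ M G x q (fun n => min (n:ℝ) (c^2/1024 * s^2)) ≤ s := by
  have hs0 : 0 < s := by linarith
  have hΩ := C.hΩ0
  have hop : 7/10 ≤ Ω * pc := C.omega_p C.pc0.le le_rfl x (by rw [hX]; linarith)
  have hpc := C.pc_le x
  have hΩ70 : 70 ≤ Ω := by nlinarith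
  have hLs : L / s ≤ 1/40 := by rw [div_le_iff₀ hs0]; linarith
  have hLs0 : 0 < L / s := by positivity
  have hq50 : q ≤ 1/50 := by nlinarith
  refine ⟨hq50, ?_⟩
  obtain ⟨e, he⟩ : ∃ e, e = 20 * (L / s) := ⟨_, rfl⟩
  have he0 : 0 < e := by rw [he]; positivity
  obtain ⟨p0, hp0⟩ : ∃ p0, p0 = pc - e / Ω := ⟨_, rfl⟩
  have hΩp0 : Ω * p0 = Ω * pc - e := by rw [hp0]; field_simp
  have hp00 : 0 ≤ p0 := by
    by_contra h; push Not at h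
    have : Ω * p0 < 0 := mul_neg_of_pos_of_neg hΩ h
    linarith
  have hp0c : p0 ≤ pc := by
    rw [hp0]; have : 0 ≤ e / Ω := by positivity
    linarith
  have hp01 : p0 ≤ 1 := by linarith
  have hlow := C.lower_int hp00 hp0c le_rfl x
  have hupp := C.upper_int_id hp00 hp0c (by linarith) x
  have hd1 : Ω * (pc - p0) = e := by linarith [mul_sub Ω pc p0]
  rw [mul_assoc, hd1, hX] at hlow hupp
  have hx1 := one_le_X (G := G) hp00 hp01 x
  obtain ⟨x0, hx0⟩ : ∃ x0, x0 = X G x p0 := ⟨_, rfl⟩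
  rw [← hx0] at hlow hupp hx1
  have hcpos : 0 < c := by rw [hc]; positivity
  have hinv : x0⁻¹ ≤ (c * s)⁻¹ := by
    have : (c * s)⁻¹ = (lam * s)⁻¹ + 21 * (L / s) := by
      rw [hc, mul_inv, inv_inv]; field_simp
    rw [this]; linarith
  have hx0c : c * s ≤ x0 := by
    rwa [inv_le_inv₀ (by linarith) (by positivity)] at hinv
  have hL := C.lemL hp00 hp0c x (by rw [← hx0]; linarith)
  rw [← hx0] at hL
  have hk1 : 1 ≤ x0^2/1024 := by nlinarith
  have hM0 : M G x p0 (fun n => min (n:ℝ) (x0^2/1024)) ≤ 25/32 * x0 := by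
    have h1 : M G x p0 (fun n => min (n:ℝ) (x0^2/1024)) ≤
        M G x p0 (fun n => (n:ℝ) - 7/8 * ((n:ℝ) * ind (x0^2/128 ≤ (n:ℝ)))) := by
      apply M_mono hp00 hp01
      intro n hn
      by_cases h : x0^2/128 ≤ (n:ℝ)
      · rw [ind_true h]
        refine (min_le_right _ _).trans ?_
        linarith
      · rw [ind_false h]
        refine (min_le_left _ _).trans ?_
        linarith
    rw [M_sub, M_const_mul] at h1
    have : M G x p0 (fun n => (n:ℝ)) = x0 := hx0.symm
    linarith
  have hum := C.upper_int_min hk1 hp00 (hp0c.trans hq) hq50 x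
  have hd2 : Ω * (q - p0) ≤ e + L / s := by nlinarith
  have hMp := one_le_Mmin (G := G) hp00 hp01 hk1 x
  have hMq := one_le_Mmin (G := G) (p := q) (by linarith) (by linarith) hk1 x
  obtain ⟨m0, hm0⟩ : ∃ m0, m0 = M G x p0 (fun n => min (n:ℝ) (x0^2/1024)) := ⟨_, rfl⟩
  obtain ⟨m1, hm1⟩ : ∃ m1, m1 = M G x q (fun n => min (n:ℝ) (x0^2/1024)) := ⟨_, rfl⟩
  rw [← hm0] at hM0 hMp hum
  rw [← hm1] at hMq hum
  have h3 : (25/32 * x0)⁻¹ ≤ m0⁻¹ := by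
    rw [inv_le_inv₀ (by linarith) (by linarith)]; exact hM0
  have h4 : (25/32 * x0)⁻¹ = 32/25 * x0⁻¹ := by rw [mul_inv]; norm_num
  have h5 : 0 < (lam * s)⁻¹ := by positivity
  have h6 : s⁻¹ ≤ L / s := by rw [div_eq_mul_inv]; exact le_mul_of_one_le_left (by positivity) (by assumption)
  have h7 : s⁻¹ ≤ m1⁻¹ := by
    rw [mul_assoc] at hum
    rw [h4] at h3
    have : (50/49) * (Ω * (q - p0)) ≤ (50/49) * (e + L/s) := by linarith
    linarith
  have h8 : m1 ≤ s := by rwa [inv_le_inv₀ hs0 (by linarith)] at h7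
  refine le_trans ?_ h8
  rw [hm1]
  apply M_mono (by linarith) (by linarith)
  intro n hn
  apply min_le_min le_rfl
  have : (c * s)^2 ≤ x0^2 := by gcongr
  nlinarith

end window
end PW

set_option linter.unusedSectionVars false
set_option linter.unusedVariables false

namespace PW
open Percolation

section chiupper
variable {V : Type} [Fintype V] {G : SimpleGraph V}

lemma q_nonneg {p : ℝ} (h0 : 0 ≤ p) (h1 : p ≤ 1) (x : V) (n : ℕ) : 0 ≤ q G p x n :=
  Ex_nonneg h0 h1 fun ω => ind_nonneg _

lemma q_eq_M (p : ℝ) (x : V) (n : ℕ) : q G p x n = M G x p (fun N => ind (n ≤ N)) := rfl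

theorem chi_upper (hT : IsTransitive G) {p s κ : ℝ} (h0 : 0 ≤ p) (h1 : p ≤ 1) (hs : 1 ≤ s)
    (hV : (Fintype.card V : ℝ) = s^3) (hκ : 0 < κ) (hκ1 : κ ≤ 1) (x : V)
    (hM : M G x p (fun n => min (n:ℝ) (κ * s^2)) ≤ s) : X G x p ≤ 49/κ^2 * s := by
  have hk : 0 < κ * s^2 := by positivity
  have hs0 : 0 < s := by linarith
  -- tail bound
  have hq : ∀ n : ℕ, κ * s^2 ≤ n → q G p x n ≤ 1/(κ * s) := by
    intro n hn
    have : κ * s^2 * q G p x n ≤ M G x p (fun n => min (n:ℝ) (κ * s^2)) := by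
      rw [q_eq_M, ← M_const_mul]
      apply M_mono h0 h1
      intro N hN
      by_cases h : n ≤ N
      · rw [ind_true h, mul_one]
        exact le_min (hn.trans (by exact_mod_cast h)) le_rfl
      · rw [ind_false h, mul_zero]
        exact le_min (by positivity) hk.le
    rw [le_div_iff₀ (by positivity)]
    have h2 : s * (q G p x n * (κ * s)) ≤ s * 1 := by nlinarith
    exact le_of_mul_le_mul_left h2 hs0
  obtain ⟨m, hm⟩ : ∃ m : ℕ, m = ⌈6/κ * s^2⌉₊ := ⟨_, rfl⟩
  have hm1 : 6/κ * s^2 ≤ m := by rw [hm]; exact Nat.le_ceil _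
  have hκi : 1 ≤ 1/κ := by rw [le_div_iff₀ hκ]; linarith
  have hs2 : 1 ≤ s^2 := by nlinarith
  have hm2 : (m:ℝ) ≤ 7/κ * s^2 := by
    have : (m:ℝ) < 6/κ * s^2 + 1 := by rw [hm]; exact Nat.ceil_lt_add_one (by positivity)
    have h7 : 7/κ * s^2 = 6/κ * s^2 + 1/κ * s^2 := by ring
    have : 1 ≤ 1/κ * s^2 := by nlinarith
    linarith
  have hkm : κ * s^2 ≤ m := by
    refine le_trans ?_ hm1
    have : κ ≤ 6/κ := by rw [le_div_iff₀ hκ]; nlinarith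
    gcongr
  have hmpos : 0 < (m:ℝ) := by linarith
  have hmp : 1 ≤ m := by exact_mod_cast hmpos
  have hstep : ∀ n : ℕ, m ≤ n → q G p x (3*n) ≤ q G p x n / 6 := by
    intro n hn
    have hn' : (m:ℝ) ≤ n := by exact_mod_cast hn
    have h2 := q_split hT h0 h1 x (n := n) (by omega)
    have h3 := hq n (by linarith)
    have h4 := q_nonneg (G := G) h0 h1 x n
    have h5 : q G p x n * ((Fintype.card V : ℝ) * q G p x n) ≤ q G p x n * (s^3 * (1/(κ*s))) := by
      rw [hV]; gcongr
    have h6 : s^3 * (1/(κ*s)) = s^2/κ := by field_simp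
    have h7 : s^2/κ ≤ n/6 := by
      have : 6/κ * s^2 = 6 * (s^2/κ) := by ring
      linarith
    have h8 : (n:ℝ) * q G p x (3*n) ≤ n * (q G p x n / 6) := by
      rw [h6] at h5
      nlinarith [mul_le_mul_of_nonneg_left h7 h4]
    exact le_of_mul_le_mul_left h8 (by linarith)
  have hqj : ∀ j : ℕ, q G p x (3^j*m) ≤ 1/(κ*s) / 6^j := by
    intro j
    induction j with
    | zero => simpa using hq m hkm
    | succ j ih =>
      have h2 := hstep (3^j*m) (Nat.le_mul_of_pos_left _ (by positivity))
      have : 3^(j+1)*m = 3*(3^j*m) := by ring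
      rw [this]
      refine h2.trans ?_
      rw [pow_succ, ← div_div]
      linarith
  have ha0 : M G x p (fun n => min (n:ℝ) m) ≤ 7/κ^2 * s := by
    have h2 : M G x p (fun n => min (n:ℝ) m) ≤ M G x p (fun n => (m/(κ*s^2)) * min (n:ℝ) (κ*s^2)) := by
      apply M_mono h0 h1
      intro n hn
      have h3 : 1 ≤ m/(κ*s^2) := by rw [le_div_iff₀ hk]; linarith
      rcases le_total (n:ℝ) (κ*s^2) with h | h
      · rw [min_eq_left h]
        refine (min_le_left _ _).trans ?_
        exact le_mul_of_one_le_left (by positivity) h3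
      · rw [min_eq_right h]
        refine (min_le_right _ _).trans (le_of_eq ?_)
        field_simp
    rw [M_const_mul] at h2
    refine h2.trans ?_
    have h3 : m/(κ*s^2) ≤ 7/κ^2 := by
      rw [div_le_iff₀ hk]
      refine hm2.trans (le_of_eq ?_)
      field_simp
    calc m/(κ*s^2) * M G x p (fun n => min (n:ℝ) (κ*s^2)) ≤ m/(κ*s^2) * s := by gcongr
      _ ≤ _ := by gcongr
  have haJ : ∀ J : ℕ, M G x p (fun n => min (n:ℝ) (3^J*m)) ≤ 7/κ^2 * s + 6*m/(κ*s) * (1 - (1/2)^J) := by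
    intro J
    induction J with
    | zero => simpa using ha0
    | succ J ih =>
      have h2 : M G x p (fun n => min (n:ℝ) (3^(J+1)*m)) ≤
          M G x p (fun n => min (n:ℝ) (3^J*m) + (3^(J+1)*m) * ind (3^J*m ≤ n)) := by
        apply M_mono h0 h1
        intro n hn
        by_cases h : 3^J*m ≤ n
        · rw [ind_true h, mul_one]
          have : 0 ≤ min (n:ℝ) (3^J*m) := by positivity
          linarith [min_le_right (n:ℝ) (3^(J+1)*m)]
        · rw [ind_false h, mul_zero, add_zero]
          push Not at h
          have : (n:ℝ) ≤ 3^J*m := by exact_mod_cast h.le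
          rw [min_eq_left this]
          exact min_le_left _ _
      rw [M_add, M_const_mul, ← q_eq_M] at h2
      have h3 : (3^(J+1)*m : ℝ) * q G p x (3^J*m) ≤ (3^(J+1)*m : ℝ) * (1/(κ*s) / 6^J) := by
        have := hqj J
        gcongr
      have h4 : (3^(J+1)*m : ℝ) * (1/(κ*s) / 6^J) = 6*m/(κ*s) * ((1/2)^J - (1/2)^(J+1)) := by
        have : (6:ℝ)^J = 3^J * 2^J := by rw [← mul_pow]; norm_num
        rw [this, pow_succ, pow_succ, div_pow, one_pow]
        field_simp
        ring
      rw [h4] at h3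
      linarith
  have hfin := haJ (Fintype.card V)
  have h2 : X G x p ≤ M G x p (fun n => min (n:ℝ) (3^(Fintype.card V)*m)) := by
    apply Ex_mono h0 h1
    intro ω
    refine le_min le_rfl ?_
    have h3 : (Cl ω x).card ≤ Fintype.card V := Finset.card_le_univ _
    have h4 : Fintype.card V ≤ 3^(Fintype.card V) * m := by
      have h5 : Fintype.card V < 3^(Fintype.card V) := Nat.lt_pow_self (by norm_num)
      exact h5.le.trans (Nat.le_mul_of_pos_right _ (by omega))
    show ((Cl ω x).card : ℝ) ≤ _
    exact_mod_cast h3.trans h4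
  have h5 : 6*m/(κ*s) * (1 - (1/2)^(Fintype.card V)) ≤ 6*m/(κ*s) * 1 := by
    have : 0 ≤ (1/2:ℝ)^(Fintype.card V) := by positivity
    gcongr
    linarith
  have h6 : 6*m/(κ*s) ≤ 42/κ^2 * s := by
    rw [div_le_iff₀ (by positivity)]
    have : 42/κ^2*s*(κ*s) = 6 * (7/κ*s^2) := by field_simp; ring
    rw [this]; linarith
  have h7 : 49/κ^2*s = 7/κ^2*s + 42/κ^2*s := by ring
  linarith

end chiupper
end PW

set_option linter.unusedSectionVars false
set_option linter.unusedVariables false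

namespace PW
open Percolation

section cmax
variable {V : Type} [Fintype V] {G : SimpleGraph V}

/-- largest cluster -/
def Cm (ω : G.edgeSet → Bool) : ℕ := Finset.univ.sup fun x => (Cl ω x).card

lemma card_le_Cm (ω : G.edgeSet → Bool) (x : V) : (Cl ω x).card ≤ Cm ω :=
  Finset.le_sup (f := fun x => (Cl ω x).card) (Finset.mem_univ x)

lemma exists_Cm [Nonempty V] (ω : G.edgeSet → Bool) : ∃ x, (Cl ω x).card = Cm ω := by
  obtain ⟨x, _, hx⟩ := Finset.exists_mem_eq_sup Finset.univ Finset.univ_nonempty (fun x => (Cl ω x).card)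
  exact ⟨x, hx.symm⟩

lemma Cm_le (ω : G.edgeSet → Bool) : Cm ω ≤ Fintype.card V :=
  Finset.sup_le fun x _ => Finset.card_le_univ _

lemma one_le_Cm (x : V) (ω : G.edgeSet → Bool) : 1 ≤ Cm ω :=
  le_trans (Finset.card_pos.2 ⟨x, self_mem_cl _ _⟩) (card_le_Cm ω x)

lemma Cm_mono {ω ω' : G.edgeSet → Bool} (h : ω ≤ ω') : Cm ω ≤ Cm ω' :=
  Finset.sup_mono_fun fun x _ => Finset.card_le_card (cl_mono h x)

lemma Cm_sq [Nonempty V] (ω : G.edgeSet → Bool) : ((Cm ω : ℕ) : ℝ)^2 ≤ ∑ y, ((Cl ω y).card : ℝ) := by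
  obtain ⟨x, hx⟩ := exists_Cm ω
  rw [← hx]
  calc ((Cl ω x).card : ℝ)^2 = ∑ y ∈ Cl ω x, ((Cl ω y).card : ℝ) := by
        rw [Finset.sum_congr rfl (fun y hy => by rw [cl_eq hy]), Finset.sum_const, nsmul_eq_mul, sq]
    _ ≤ _ := Finset.sum_le_univ_sum_of_nonneg fun y => by positivity

lemma Ex_Cm_sq (hT : IsTransitive G) {p : ℝ} (h0 : 0 ≤ p) (h1 : p ≤ 1) (x : V) :
    Ex p (fun ω : G.edgeSet → Bool => (Cm ω : ℝ)^2) ≤ Fintype.card V * X G x p := by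
  have : Nonempty V := ⟨x⟩
  calc _ ≤ Ex p (fun ω : G.edgeSet → Bool => ∑ y, ((Cl ω y).card : ℝ)) := Ex_mono h0 h1 fun ω => Cm_sq ω
    _ = ∑ y, X G x p := by
      rw [Ex_sum]
      exact Finset.sum_congr rfl fun y _ => Ex_card_eq hT p (fun n => (n:ℝ)) y x
    _ = _ := by rw [Finset.sum_const, nsmul_eq_mul, Finset.card_univ]

lemma second_moment (hT : IsTransitive G) {p : ℝ} (h0 : 0 ≤ p) (h1 : p ≤ 1) (x : V) :
    Ex p (fun ω : G.edgeSet → Bool => ((Cl ω x).card : ℝ)^2) ≤ X G x p ^ 3 := by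
  have hX : ∀ w, ∑ y, T G p w y = X G x p := fun w => by
    rw [sum_T]; exact Ex_card_eq hT p (fun n => (n:ℝ)) w x
  calc _ = ∑ a, ∑ b, Ex p (fun ω : G.edgeSet → Bool => ind (a ∈ Cl ω x) * ind (b ∈ Cl ω x)) := by
        simp only [← Ex_sum]
        congr 1; funext ω
        rw [sq, card_eq_sum, Finset.sum_mul_sum]
    _ ≤ ∑ a, ∑ b, ∑ w, T G p x w * T G p w a * T G p w b :=
        Finset.sum_le_sum fun a _ => Finset.sum_le_sum fun b _ => tree_graph h0 h1 x a b
    _ = ∑ w, T G p x w * (∑ a, T G p w a) * (∑ b, T G p w b) := by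
        have : ∀ a : V, ∑ b, ∑ w, T G p x w * T G p w a * T G p w b = ∑ w, ∑ b, T G p x w * T G p w a * T G p w b :=
          fun a => Finset.sum_comm
        simp only [this]
        rw [Finset.sum_comm]
        refine Finset.sum_congr rfl fun w _ => ?_
        rw [mul_assoc, Finset.sum_mul_sum, Finset.mul_sum]
        refine Finset.sum_congr rfl fun a _ => ?_
        rw [Finset.mul_sum]
        exact Finset.sum_congr rfl fun b _ => by ring
    _ = _ := by
        simp only [hX]
        rw [← Finset.sum_mul, ← Finset.sum_mul, hX]; ring

lemma pair_bound (hT : IsTransitive G) {p : ℝ} (h0 : 0 ≤ p) (h1 : p ≤ 1) (k : ℝ) (x y z : V) :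
    Ex p (fun ω : G.edgeSet → Bool => ind (k ≤ ((Cl ω y).card:ℝ)) * ind (k ≤ ((Cl ω z).card:ℝ))) ≤
      T G p y z + M G x p (fun n => ind (k ≤ (n:ℝ))) ^ 2 := by
  have hM : ∀ y, Ex p (fun ω : G.edgeSet → Bool => ind (k ≤ ((Cl ω y).card:ℝ))) = M G x p (fun n => ind (k ≤ (n:ℝ))) :=
    fun y => Ex_card_eq hT p (fun n => ind (k ≤ (n:ℝ))) y x
  calc _ ≤ Ex p (fun ω : G.edgeSet → Bool => ind (z ∈ Cl ω y) + ind (z ∉ Cl ω y) *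
          (ind (k ≤ ((Cl ω y).card:ℝ)) * ind (k ≤ ((Cl ω z).card:ℝ)))) := by
        refine Ex_mono h0 h1 fun ω => ?_
        by_cases h : z ∈ Cl ω y
        · rw [ind_true h, ind_false (not_not.2 h)]
          have := mul_le_one₀ (ind_le_one (k ≤ ((Cl ω y).card:ℝ))) (ind_nonneg _) (ind_le_one (k ≤ ((Cl ω z).card:ℝ)))
          linarith
        · rw [ind_false h, ind_true h]; linarith
    _ = T G p y z + Ex p (fun ω : G.edgeSet → Bool => ind (z ∉ Cl ω y) *
          (ind (k ≤ ((Cl ω y).card:ℝ)) * ind (k ≤ ((Cl ω z).card:ℝ)))) := Ex_add _ _ _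
    _ ≤ T G p y z + M G x p (fun n => ind (k ≤ (n:ℝ))) ^ 2 := by
        gcongr
        rw [decouple p y z (fun A B => ind (k ≤ (A.card:ℝ)) * ind (k ≤ (B.card:ℝ)))]
        calc _ ≤ Ex p (fun ω : G.edgeSet → Bool => ind (k ≤ ((Cl ω y).card:ℝ)) * M G x p (fun n => ind (k ≤ (n:ℝ)))) := by
              refine Ex_mono h0 h1 fun ω => ?_
              rw [Ex_const_mul]
              have h2 : Ex p (fun ω' : G.edgeSet → Bool => ind (k ≤ ((ClO ω' (Cl ω y) z).card:ℝ))) ≤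
                  M G x p (fun n => ind (k ≤ (n:ℝ))) := by
                rw [← hM z]
                refine Ex_mono h0 h1 fun ω' => ind_mono fun h => h.trans ?_
                exact_mod_cast Finset.card_le_card (cl_mono (restr_le _ _) z)
              have h3 := ind_nonneg (k ≤ ((Cl ω y).card:ℝ))
              have h4 : 0 ≤ Ex p (fun ω' : G.edgeSet → Bool => ind (k ≤ ((ClO ω' (Cl ω y) z).card:ℝ))) :=
                Ex_nonneg h0 h1 fun _ => ind_nonneg _
              calc _ ≤ 1 * (ind (k ≤ ((Cl ω y).card:ℝ)) *
                    Ex p (fun ω' : G.edgeSet → Bool => ind (k ≤ ((ClO ω' (Cl ω y) z).card:ℝ)))) :=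
                    mul_le_mul_of_nonneg_right (ind_le_one _) (mul_nonneg h3 h4)
                _ ≤ _ := by rw [one_mul]; exact mul_le_mul_of_nonneg_left h2 h3
          _ = _ := by rw [Ex_mul_const, hM]; ring

/-- the second moment method -/
theorem cmax_low_aux (hT : IsTransitive G) {p : ℝ} (h0 : 0 ≤ p) (h1 : p ≤ 1) (k : ℝ) (x : V) :
    Ex p (fun ω : G.edgeSet → Bool => ind ((Cm ω : ℝ) < k)) *
      (Fintype.card V * M G x p (fun n => ind (k ≤ (n:ℝ)))) ^ 2 ≤ Fintype.card V * X G x p := by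
  obtain ⟨P, hP⟩ : ∃ P, P = M G x p (fun n => ind (k ≤ (n:ℝ))) := ⟨_, rfl⟩
  obtain ⟨v, hv⟩ : ∃ v : ℝ, v = Fintype.card V := ⟨_, rfl⟩
  have hM : ∀ y, Ex p (fun ω : G.edgeSet → Bool => ind (k ≤ ((Cl ω y).card:ℝ))) = P :=
    fun y => by rw [hP]; exact Ex_card_eq hT p (fun n => ind (k ≤ (n:ℝ))) y x
  have hX : ∀ w, ∑ y, T G p w y = X G x p := fun w => by
    rw [sum_T]; exact Ex_card_eq hT p (fun n => (n:ℝ)) w x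
  rw [← hP, ← hv]
  let Z : (G.edgeSet → Bool) → ℝ := fun ω => ∑ y, ind (k ≤ ((Cl ω y).card:ℝ))
  have hZ1 : Ex p Z = v * P := by
    show Ex p (fun ω => ∑ y, ind (k ≤ ((Cl ω y).card:ℝ))) = _
    rw [Ex_sum]
    simp only [hM]
    rw [Finset.sum_const, nsmul_eq_mul, Finset.card_univ, hv]
  have hZ2 : Ex p (fun ω => Z ω ^ 2) ≤ v * X G x p + (v * P)^2 := by
    calc _ = ∑ a, ∑ b, Ex p (fun ω : G.edgeSet → Bool => ind (k ≤ ((Cl ω a).card:ℝ)) * ind (k ≤ ((Cl ω b).card:ℝ))) := by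
          simp only [← Ex_sum]
          congr 1; funext ω
          simp only [Z]
          rw [sq, Finset.sum_mul_sum]
      _ ≤ ∑ a, ∑ b, (T G p a b + P^2) := by
          rw [hP]
          exact Finset.sum_le_sum fun a _ => Finset.sum_le_sum fun b _ => pair_bound hT h0 h1 k x a b
      _ = _ := by
          simp only [Finset.sum_add_distrib, hX, Finset.sum_const, nsmul_eq_mul, Finset.card_univ, ← hv]
          ring
  calc _ = Ex p (fun ω : G.edgeSet → Bool => ind ((Cm ω : ℝ) < k) * (v * P)^2) := (Ex_mul_const _ _ _).symm
    _ ≤ Ex p (fun ω => Z ω ^ 2 - (2 * (v * P)) * Z ω + (v*P)^2) := by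
        refine Ex_mono h0 h1 fun ω => ?_
        by_cases h : (Cm ω : ℝ) < k
        · have : Z ω = 0 := by
            simp only [Z]
            refine Finset.sum_eq_zero fun y _ => ind_false ?_
            push Not
            refine lt_of_le_of_lt ?_ h
            exact_mod_cast card_le_Cm ω y
          rw [ind_true h, this]; nlinarith
        · rw [ind_false h]; nlinarith [sq_nonneg (Z ω - v * P)]
    _ = Ex p (fun ω => Z ω ^ 2) - (2 * (v*P)) * (v * P) + (v*P)^2 := by
        rw [Ex_add, Ex_sub, Ex_const_mul, Ex_const, hZ1]
    _ ≤ _ := by nlinarith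

theorem Ctx.cmax_low {Ω pc : ℝ} (C : Ctx G Ω pc) {p : ℝ} (h0 : 0 ≤ p) (h : p ≤ pc) (x : V) (hX : 4 ≤ X G x p) :
    Ex p (fun ω : G.edgeSet → Bool => ind ((Cm ω : ℝ) < X G x p ^ 2 / 128)) ≤
      256 * X G x p ^ 3 / Fintype.card V := by
  have h1 : p ≤ 1 := h.trans C.pc1.le
  have hv : (0:ℝ) < Fintype.card V := by exact_mod_cast Fintype.card_pos_iff.2 ⟨x⟩
  have hL := C.lemL h0 h x hX
  have hA := cmax_low_aux C.hT h0 h1 (X G x p ^ 2 / 128) x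
  have hS := second_moment C.hT h0 h1 x
  have hC := Ex_cauchy h0 h1 (fun ω : G.edgeSet → Bool => ((Cl ω x).card : ℝ))
    (fun ω => ind (X G x p ^ 2 / 128 ≤ ((Cl ω x).card : ℝ)))
  have hsq : ∀ Q : Prop, ind Q ^ 2 = ind Q := fun Q => by
    by_cases h : Q
    · rw [ind_true h, one_pow]
    · rw [ind_false h]; ring
  simp only [hsq] at hC
  obtain ⟨P, hP⟩ : ∃ P, P = M G x p (fun n => ind (X G x p ^ 2 / 128 ≤ (n:ℝ))) := ⟨_, rfl⟩
  have hC' : (M G x p (fun n => (n:ℝ) * ind (X G x p ^ 2 / 128 ≤ (n:ℝ))))^2 ≤ X G x p ^ 3 * P := by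
    refine hC.trans ?_
    rw [hP]
    exact mul_le_mul_of_nonneg_right hS (Ex_nonneg h0 h1 fun _ => ind_nonneg _)
  rw [← hP] at hA
  obtain ⟨t, ht⟩ : ∃ t, t = Ex p (fun ω : G.edgeSet → Bool => ind ((Cm ω : ℝ) < X G x p ^ 2 / 128)) := ⟨_, rfl⟩
  have ht0 : 0 ≤ t := by rw [ht]; exact Ex_nonneg h0 h1 fun _ => ind_nonneg _
  rw [← ht] at hA ⊢
  generalize X G x p = a at *
  generalize (Fintype.card V : ℝ) = v at *
  have h3 : (a/4)^2 ≤ a^3 * P := le_trans (by gcongr) hC'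
  have h4 : 1 ≤ 16 * a * P := by
    have : a^2 * 1 ≤ a^2 * (16 * a * P) := by nlinarith
    exact le_of_mul_le_mul_left this (by positivity)
  rw [le_div_iff₀ hv]
  have h5 : v * (t * v * 1) ≤ v * (t * v * (16 * a * P)^2) := by
    have : (1:ℝ) ≤ (16*a*P)^2 := by nlinarith
    gcongr
  have h6 : v * (t * v * (16 * a * P)^2) = 256 * a^2 * (t * (v * P)^2) := by ring
  have h7 : 256 * a^2 * (t * (v * P)^2) ≤ 256 * a^2 * (v * a) := by gcongr
  have h8 : v * (t * v) ≤ v * (256 * a^3) := by nlinarith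
  exact le_of_mul_le_mul_left h8 hv

end cmax
end PW

set_option linter.unusedSectionVars false
set_option linter.unusedVariables false

namespace PW
open Percolation

section concl
variable {V : Type} [Fintype V] {G : SimpleGraph V}

/-- the conclusion of the theorem -/
structure Concl (G : SimpleGraph V) (x : V) (p s b4 b5 b6 b7 b8 : ℝ) : Prop where
  c4 : b4 * s^2 ≤ Ex p (fun ω : G.edgeSet → Bool => (Cm ω : ℝ))
  c5 : Ex p (fun ω : G.edgeSet → Bool => (Cm ω : ℝ)) ≤ b5 * s^2
  c6 : ∀ w : ℝ, 1 ≤ w → 1 - b6 / w ≤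
    Ex p (fun ω : G.edgeSet → Bool => ind (w⁻¹ * s^2 ≤ (Cm ω : ℝ) ∧ (Cm ω : ℝ) ≤ w * s^2))
  c7 : b7 * s ≤ X G x p
  c8 : X G x p ≤ b8 * s

lemma Concl.mono {x : V} {p s b4 b5 b6 b7 b8 b4' b5' b6' b7' b8' : ℝ} (hs : 0 ≤ s)
    (h : Concl G x p s b4 b5 b6 b7 b8) (h4 : b4' ≤ b4) (h5 : b5 ≤ b5') (h6 : b6 ≤ b6') (h7 : b7' ≤ b7)
    (h8 : b8 ≤ b8') : Concl G x p s b4' b5' b6' b7' b8' where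
  c4 := le_trans (by gcongr) h.c4
  c5 := h.c5.trans (by gcongr)
  c6 := fun w hw => by
    refine le_trans ?_ (h.c6 w hw)
    have : b6 / w ≤ b6' / w := by gcongr
    linarith
  c7 := le_trans (by gcongr) h.c7
  c8 := h.c8.trans (by gcongr)

lemma X_le_card {p : ℝ} (h0 : 0 ≤ p) (h1 : p ≤ 1) (x : V) : X G x p ≤ Fintype.card V := by
  have : Ex p (fun _ : G.edgeSet → Bool => (Fintype.card V : ℝ)) = Fintype.card V := Ex_const _ _
  rw [← this]
  refine Ex_mono h0 h1 fun ω => ?_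
  show ((Cl ω x).card : ℝ) ≤ _
  exact_mod_cast Finset.card_le_univ _

theorem small {p s s0 : ℝ} (h0 : 0 ≤ p) (h1 : p ≤ 1) (x : V) (hs1 : 1 ≤ s) (hss : s ≤ s0)
    (hV : (Fintype.card V : ℝ) = s^3) :
    Concl G x p s (1/s0^2) s0 (s0^2) (1/s0) (s0^2) := by
  have hs0 : 1 ≤ s0 := hs1.trans hss
  have hC1 : ∀ ω : G.edgeSet → Bool, (1:ℝ) ≤ Cm ω := fun ω => by exact_mod_cast one_le_Cm x ω
  have hCV : ∀ ω : G.edgeSet → Bool, (Cm ω : ℝ) ≤ s^3 := fun ω => by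
    rw [← hV]; exact_mod_cast Cm_le ω
  have hE1 : (1:ℝ) ≤ Ex p (fun ω : G.edgeSet → Bool => (Cm ω : ℝ)) := by
    have := Ex_mono h0 h1 hC1
    rwa [Ex_const] at this
  have hE2 : Ex p (fun ω : G.edgeSet → Bool => (Cm ω : ℝ)) ≤ s^3 := by
    have := Ex_mono h0 h1 hCV
    rwa [Ex_const] at this
  have hsq : s^2 ≤ s0^2 := by gcongr
  refine ⟨?_, ?_, ?_, ?_, ?_⟩
  · refine le_trans ?_ hE1
    rw [div_mul_eq_mul_div, div_le_iff₀ (by positivity)]; linarith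
  · refine hE2.trans ?_
    have : s^3 = s * s^2 := by ring
    rw [this]; gcongr
  · intro w hw
    by_cases h : w < s0^2
    · have : 1 ≤ s0^2 / w := by rw [le_div_iff₀ (by linarith)]; linarith
      have h2 : 0 ≤ Ex p (fun ω : G.edgeSet → Bool => ind (w⁻¹ * s^2 ≤ (Cm ω : ℝ) ∧ (Cm ω : ℝ) ≤ w * s^2)) :=
        Ex_nonneg h0 h1 fun _ => ind_nonneg _
      linarith
    · push Not at h
      have h2 : ∀ ω : G.edgeSet → Bool, 1 ≤ ind (w⁻¹ * s^2 ≤ (Cm ω : ℝ) ∧ (Cm ω : ℝ) ≤ w * s^2) := by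
        intro ω
        rw [ind_true]
        constructor
        · refine le_trans ?_ (hC1 ω)
          rw [inv_mul_le_iff₀ (by linarith)]; linarith
        · refine (hCV ω).trans ?_
          have h3 : s ≤ w := by nlinarith
          have : s^3 = s * s^2 := by ring
          rw [this]; gcongr
      have h3 := Ex_mono h0 h1 h2
      rw [Ex_const] at h3
      have : 0 ≤ s0^2 / w := by positivity
      linarith
  · refine le_trans ?_ (one_le_X h0 h1 x)
    rw [div_mul_eq_mul_div, div_le_iff₀ (by positivity)]; linarith
  · refine (X_le_card h0 h1 x).trans ?_
    rw [hV]
    have : s^3 = s^2 * s := by ring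
    rw [this]; gcongr

/-- Lower tail of the largest cluster. -/
theorem Ctx.low_tail {Ω pc : ℝ} (C : Ctx G Ω pc) {lam s c p w : ℝ} (x : V) (hlam : 0 < lam) (hs : 0 < s)
    (hV : (Fintype.card V : ℝ) = s^3) (hX : X G x pc = lam * s) (hc : 0 < c) (h0 : 0 ≤ p) (h1 : p ≤ 1)
    (hlow : c * s ≤ X G x (min p pc)) (hw : 1 ≤ w) :
    Ex p (fun ω : G.edgeSet → Bool => ind ((Cm ω : ℝ) < w⁻¹ * s^2)) ≤ (32768 * lam + 128 / c^2) / w := by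
  have hw0 : 0 < w := by linarith
  have hle1 : Ex p (fun ω : G.edgeSet → Bool => ind ((Cm ω : ℝ) < w⁻¹ * s^2)) ≤ 1 := by
    have := Ex_mono (f := fun ω : G.edgeSet → Bool => ind ((Cm ω : ℝ) < w⁻¹ * s^2)) h0 h1 (fun ω => ind_le_one _)
    rwa [Ex_const] at this
  have hpm0 : 0 ≤ min p pc := le_min h0 C.pc0.le
  have hpm1 : min p pc ≤ 1 := (min_le_left _ _).trans h1
  by_cases hA : w ≤ 128 / c^2
  · refine hle1.trans ?_
    rw [le_div_iff₀ hw0]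
    have : 0 < 32768 * lam := by positivity
    linarith
  push Not at hA
  by_cases hB : w⁻¹ * s^2 ≤ 1
  · have h2 : Ex p (fun ω : G.edgeSet → Bool => ind ((Cm ω : ℝ) < w⁻¹ * s^2)) ≤ Ex p (fun _ : G.edgeSet → Bool => (0:ℝ)) := by
      refine Ex_mono h0 h1 fun ω => le_of_eq (ind_false ?_)
      push Not
      refine hB.trans ?_
      exact_mod_cast one_le_Cm x ω
    rw [Ex_const] at h2
    refine h2.trans ?_
    positivity
  push Not at hB
  obtain ⟨a, ha⟩ : ∃ a, a = Real.sqrt (128 * (w⁻¹ * s^2)) := ⟨_, rfl⟩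
  have ha2 : a^2 = 128 * (w⁻¹ * s^2) := by rw [ha]; exact Real.sq_sqrt (by positivity)
  have ha0 : 0 ≤ a := by rw [ha]; exact Real.sqrt_nonneg _
  have ha4 : 4 ≤ a := by nlinarith
  have hac : a ≤ c * s := by
    refine (sq_le_sq₀ ha0 (by positivity)).1 ?_
    rw [ha2, mul_pow]
    have : 128 * w⁻¹ ≤ c^2 := by
      rw [div_lt_iff₀ (by positivity)] at hA
      rw [← div_eq_mul_inv, div_le_iff₀ hw0]; linarith
    nlinarith [sq_nonneg s]
  have hcont : ContinuousOn (fun t => X G x t) (Set.Icc 0 (min p pc)) := fun t _ =>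
    (hasDerivAt_M x (fun n => (n:ℝ)) t).continuousAt.continuousWithinAt
  have hivt := intermediate_value_Icc hpm0 hcont
  obtain ⟨p1, ⟨hp10, hp1m⟩, hp1⟩ := hivt (show a ∈ Set.Icc (X G x 0) (X G x (min p pc)) from
    ⟨by rw [X_zero]; linarith, hac.trans hlow⟩)
  simp only at hp1
  have hp1c : p1 ≤ pc := hp1m.trans (min_le_right _ _)
  have hp1p : p1 ≤ p := hp1m.trans (min_le_left _ _)
  have hlo := C.cmax_low hp10 hp1c x (by rw [hp1]; exact ha4)
  rw [hp1, hV] at hlo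
  have hk : a^2/128 = w⁻¹ * s^2 := by rw [ha2]; ring
  rw [hk] at hlo
  have halam : a ≤ lam * s := by
    rw [← hp1, ← hX]; exact X_mono_p hp10 hp1c C.pc1.le x
  have hmono : Ex p (fun ω : G.edgeSet → Bool => ind ((Cm ω : ℝ) < w⁻¹ * s^2)) ≤
      Ex p1 (fun ω : G.edgeSet → Bool => ind ((Cm ω : ℝ) < w⁻¹ * s^2)) := by
    have hm : Monotone (fun ω : G.edgeSet → Bool => -1 * ind ((Cm ω : ℝ) < w⁻¹ * s^2)) := by
      intro ω ω' hω
      have : ind ((Cm ω' : ℝ) < w⁻¹ * s^2) ≤ ind ((Cm ω : ℝ) < w⁻¹ * s^2) := by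
        refine ind_mono fun h => lt_of_le_of_lt ?_ h
        exact_mod_cast Cm_mono hω
      simp only; linarith
    have := Ex_monotone_p hm hp10 hp1p h1
    rw [Ex_const_mul, Ex_const_mul] at this
    linarith
  refine hmono.trans (hlo.trans ?_)
  rw [div_le_div_iff₀ (by positivity) hw0]
  have h3 : a^3 * w ≤ (lam * s) * (128 * s^2) := by
    have : a^3 * w = a * (128 * s^2) := by
      have : a^3 = a * a^2 := by ring
      rw [this, ha2]; field_simp
    rw [this]; gcongr
  have h4 : 0 < 128 / c^2 * s^3 := by positivity
  nlinarith

theorem Ctx.large {Ω pc : ℝ} (C : Ctx G Ω pc) {lam L s p c c2 B : ℝ} (x : V) (hlam : 0 < lam) (hL : 1 ≤ L)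
    (hV : (Fintype.card V : ℝ) = s^3)
    (hs : 40 * L ≤ s) (hX : X G x pc = lam * s) (h100 : 100 ≤ lam * s)
    (hc : c = (lam⁻¹ + 21 * L)⁻¹) (hcs : 32 ≤ c * s) (hc2 : c2 = (lam⁻¹ + 2 * L)⁻¹)
    (hB : B = 49 / (c^2/1024)^2)
    (h0 : 0 ≤ p) (h1 : p ≤ 1)
    (hp : Ω * |p - pc| ≤ L / s) :
    Concl G x p s (1 / (4 * (32768 * lam + 128 / c2^2 + B))) B (32768 * lam + 128 / c2^2 + B) c2 B := by
  have hs1 : 1 ≤ s := by linarith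
  have hs0 : 0 < s := by linarith
  have hcpos : 0 < c := by rw [hc]; positivity
  have hc2pos : 0 < c2 := by rw [hc2]; positivity
  have hc1 : c ≤ 1 := by
    rw [hc]; apply inv_le_one_of_one_le₀
    have : 0 < lam⁻¹ := by positivity
    linarith
  have hκ1 : c^2/1024 ≤ 1 := by nlinarith
  have hκ : 0 < c^2/1024 := by positivity
  have hB1 : 1 ≤ B := by
    rw [hB, le_div_iff₀ (by positivity)]; nlinarith
  have hΩ := C.hΩ0
  have hne : Nonempty V := ⟨x⟩
  -- chi upper
  have hup : X G x p ≤ B * s := by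
    obtain ⟨r, hr⟩ : ∃ r, r = max p pc := ⟨_, rfl⟩
    have hr1 : pc ≤ r := by rw [hr]; exact le_max_right _ _
    have hr2 : Ω * (r - pc) ≤ L / s := by
      refine le_trans ?_ hp
      have : r - pc ≤ |p - pc| := by
        rw [hr]
        rcases max_cases p pc with ⟨h, h'⟩ | ⟨h, h'⟩ <;> rw [h]
        · exact le_abs_self _
        · rw [sub_self]; positivity
      gcongr
    obtain ⟨hr3, hr4⟩ := C.window x hlam hL hs hX h100 hc hcs hr1 hr2
    have hr0 : 0 ≤ r := C.pc0.le.trans hr1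
    have := chi_upper C.hT hr0 (by linarith) hs1 hV hκ hκ1 x hr4
    rw [hB]
    exact (X_mono_p h0 (by rw [hr]; exact le_max_left _ _) (by linarith) x).trans this
  have hpm0 : 0 ≤ min p pc := le_min h0 C.pc0.le
  have hpm1 : min p pc ≤ 1 := (min_le_left _ _).trans h1
  -- chi lower
  have hlow : c2 * s ≤ X G x (min p pc) := by
    have h2 := C.upper_int_id hpm0 (min_le_right p pc) (by linarith [C.pc_le x]) x
    have h3 : Ω * (pc - min p pc) ≤ L / s := by
      refine le_trans ?_ hp
      have : pc - min p pc ≤ |p - pc| := by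
        rcases min_cases p pc with ⟨h, h'⟩ | ⟨h, h'⟩ <;> rw [h]
        · rw [abs_sub_comm]; exact le_abs_self _
        · rw [sub_self]; positivity
      gcongr
    have h4 : (X G x (min p pc))⁻¹ ≤ (c2 * s)⁻¹ := by
      have : (c2 * s)⁻¹ = (lam * s)⁻¹ + 2 * (L / s) := by
        rw [hc2, mul_inv, inv_inv]; field_simp
      rw [this]
      rw [mul_assoc, hX] at h2
      have : 0 < L / s := by positivity
      linarith
    rwa [inv_le_inv₀ (by linarith [one_le_X (G := G) hpm0 hpm1 x]) (by positivity)] at h4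
  have hlow' : c2 * s ≤ X G x p := hlow.trans (X_mono_p hpm0 (min_le_left _ _) h1 x)
  have hC2 : Ex p (fun ω : G.edgeSet → Bool => (Cm ω : ℝ)^2) ≤ B * s^4 := by
    refine (Ex_Cm_sq C.hT h0 h1 x).trans ?_
    rw [hV]
    have : B * s^4 = s^3 * (B * s) := by ring
    rw [this]; gcongr
  have hEC0 : 0 ≤ Ex p (fun ω : G.edgeSet → Bool => (Cm ω : ℝ)) := Ex_nonneg h0 h1 fun ω => by positivity
  have hEC : Ex p (fun ω : G.edgeSet → Bool => (Cm ω : ℝ)) ≤ B * s^2 := by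
    have h2 := Ex_cauchy h0 h1 (fun ω : G.edgeSet → Bool => (Cm ω : ℝ)) (fun _ => 1)
    simp only [mul_one, one_pow] at h2
    rw [Ex_const, mul_one] at h2
    refine (sq_le_sq₀ hEC0 (by positivity)).1 ?_
    refine h2.trans (hC2.trans ?_)
    have : (B * s^2)^2 = B * (B * s^4) := by ring
    rw [this]
    exact le_mul_of_one_le_left (by positivity) hB1
  have htail : ∀ w : ℝ, 1 ≤ w → Ex p (fun ω : G.edgeSet → Bool => ind (w * s^2 < (Cm ω : ℝ))) ≤ B / w := by
    intro w hw
    have h2 : Ex p (fun ω : G.edgeSet → Bool => ind (w * s^2 < (Cm ω : ℝ))) * (w * s^2)^2 ≤ B * s^4 := by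
      rw [← Ex_mul_const]
      refine le_trans (Ex_mono h0 h1 fun ω => ?_) hC2
      by_cases h : w * s^2 < (Cm ω : ℝ)
      · rw [ind_true h, one_mul]
        gcongr
      · rw [ind_false h, zero_mul]; positivity
    have ht0 : 0 ≤ Ex p (fun ω : G.edgeSet → Bool => ind (w * s^2 < (Cm ω : ℝ))) :=
      Ex_nonneg h0 h1 fun _ => ind_nonneg _
    generalize Ex p (fun ω : G.edgeSet → Bool => ind (w * s^2 < (Cm ω : ℝ))) = t at *
    rw [le_div_iff₀ (by linarith)]
    have h3 : s^4 * (t * w) ≤ s^4 * B := by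
      have : t * w * 1 ≤ t * w * w := by gcongr
      nlinarith [mul_le_mul_of_nonneg_left this (show 0 ≤ s^4 by positivity)]
    exact le_of_mul_le_mul_left h3 (by positivity)
  obtain ⟨D, hD⟩ : ∃ D, D = 32768 * lam + 128 / c2^2 := ⟨_, rfl⟩
  have hD0 : 0 < D := by rw [hD]; positivity
  have hwin : ∀ w : ℝ, 1 ≤ w → 1 - (D + B) / w ≤
    Ex p (fun ω : G.edgeSet → Bool => ind (w⁻¹ * s^2 ≤ (Cm ω : ℝ) ∧ (Cm ω : ℝ) ≤ w * s^2)) := by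
    intro w hw
    have h2 := htail w hw
    have h3 := C.low_tail x hlam hs0 hV hX hc2pos h0 h1 hlow hw
    rw [← hD] at h3
    have h4 : Ex p (fun ω : G.edgeSet → Bool => (1:ℝ) - ind (w * s^2 < (Cm ω : ℝ)) - ind ((Cm ω : ℝ) < w⁻¹ * s^2)) ≤
      Ex p (fun ω : G.edgeSet → Bool => ind (w⁻¹ * s^2 ≤ (Cm ω : ℝ) ∧ (Cm ω : ℝ) ≤ w * s^2)) := by
      refine Ex_mono h0 h1 fun ω => ?_
      have a1 := ind_nonneg (w * s^2 < (Cm ω : ℝ))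
      have a2 := ind_nonneg ((Cm ω : ℝ) < w⁻¹ * s^2)
      by_cases h : w⁻¹ * s^2 ≤ (Cm ω : ℝ) ∧ (Cm ω : ℝ) ≤ w * s^2
      · rw [ind_true h]; linarith
      · rw [ind_false h]
        by_cases h' : w⁻¹ * s^2 ≤ (Cm ω : ℝ)
        · have : w * s^2 < (Cm ω : ℝ) := by by_contra hh; exact h ⟨h', not_lt.1 hh⟩
          rw [ind_true this]; linarith
        · rw [ind_true (not_le.1 h')]; linarith
    rw [Ex_sub, Ex_sub, Ex_const] at h4
    rw [add_div]; linarith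
  rw [← hD]
  refine ⟨?_, hEC, hwin, hlow', hup⟩
  have h2 := hwin (2 * (D + B)) (by linarith)
  have h3 : (D + B) / (2 * (D + B)) = 1/2 := by field_simp
  rw [h3] at h2
  have h4 : Ex p (fun ω : G.edgeSet → Bool => ((2 * (D + B))⁻¹ * s^2) *
      ind ((2 * (D + B))⁻¹ * s^2 ≤ (Cm ω : ℝ) ∧ (Cm ω : ℝ) ≤ (2 * (D + B)) * s^2)) ≤
      Ex p (fun ω : G.edgeSet → Bool => (Cm ω : ℝ)) := by
    refine Ex_mono h0 h1 fun ω => ?_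
    by_cases h : (2 * (D + B))⁻¹ * s^2 ≤ (Cm ω : ℝ) ∧ (Cm ω : ℝ) ≤ (2 * (D + B)) * s^2
    · rw [ind_true h, mul_one]; exact h.1
    · rw [ind_false h, mul_zero]; positivity
  rw [Ex_const_mul] at h4
  refine le_trans ?_ h4
  have h5 : 1 / (4 * (D + B)) * s^2 = (2 * (D + B))⁻¹ * s^2 * (1/2) := by field_simp; ring
  rw [h5]
  have : 0 ≤ (2 * (D + B))⁻¹ * s^2 := by positivity
  exact mul_le_mul_of_nonneg_left (by linarith) this

end concl
end PW

open Percolation in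
/-- Theorem 1.3(ii)-(iii) (Critical window): the largest cluster and the
susceptibility inside the scaling window. -/
theorem critical_window_largest_cluster_and_susceptibility :
    ∃ b₀ : ℝ, 0 < b₀ ∧
      ∀ lam Λ : ℝ, 0 < lam →
      ∃ b₄ b₅ b₆ b₇ b₈ : ℝ,
        0 < b₄ ∧ 0 < b₅ ∧ 0 < b₆ ∧ 0 < b₇ ∧ 0 < b₈ ∧
        ∀ (V : Type) [Fintype V] [DecidableEq V]
          (G : SimpleGraph V) [DecidableRel G.Adj],
          G.Connected → IsTransitive G →
          ∀ Ω : ℕ, G.IsRegularOfDegree Ω →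
          ∀ (x₀ : V),
          1 < lam * (Fintype.card V : ℝ) ^ ((1 : ℝ) / 3) →
          lam * (Fintype.card V : ℝ) ^ ((1 : ℝ) / 3) < (Fintype.card V : ℝ) →
          b₀⁻¹ ≤ lam * (Fintype.card V : ℝ) ^ ((1 : ℝ) / 3) →
          ∀ pc : ℝ, 0 < pc → pc < 1 →
          chi G x₀ pc = lam * (Fintype.card V : ℝ) ^ ((1 : ℝ) / 3) →
          ∀ a₀ : ℝ, a₀ ≤ b₀ →
          (∀ x y : V, triangle G pc x y ≤ kron x y + a₀) →
          ∀ ε : ℝ, |ε| ≤ Λ * ((Fintype.card V : ℝ) ^ ((1 : ℝ) / 3))⁻¹ →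
          ∀ p : ℝ, p = pc + (Ω : ℝ)⁻¹ * ε → 0 ≤ p → p ≤ 1 →
          (b₄ * (Fintype.card V : ℝ) ^ ((2 : ℝ) / 3) ≤
              expect G p (fun ω => (maxCluster G ω : ℝ)) ∧
            expect G p (fun ω => (maxCluster G ω : ℝ)) ≤
              b₅ * (Fintype.card V : ℝ) ^ ((2 : ℝ) / 3)) ∧
          (∀ w : ℝ, 1 ≤ w →
            prob G p (fun ω =>
                w⁻¹ * (Fintype.card V : ℝ) ^ ((2 : ℝ) / 3) ≤ (maxCluster G ω : ℝ) ∧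
                (maxCluster G ω : ℝ) ≤ w * (Fintype.card V : ℝ) ^ ((2 : ℝ) / 3)) ≥
              1 - b₆ / w) ∧
          (b₇ * (Fintype.card V : ℝ) ^ ((1 : ℝ) / 3) ≤ chi G x₀ p ∧
            chi G x₀ p ≤ b₈ * (Fintype.card V : ℝ) ^ ((1 : ℝ) / 3)) := by
  refine ⟨1/100, by norm_num, ?_⟩
  intro lam Λ hlam
  obtain ⟨L, hL⟩ : ∃ L, L = max Λ 1 := ⟨_, rfl⟩
  have hL1 : 1 ≤ L := by rw [hL]; exact le_max_right _ _
  have hLΛ : Λ ≤ L := by rw [hL]; exact le_max_left _ _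
  obtain ⟨c, hc⟩ : ∃ c, c = (lam⁻¹ + 21 * L)⁻¹ := ⟨_, rfl⟩
  obtain ⟨c2, hc2⟩ : ∃ c2, c2 = (lam⁻¹ + 2 * L)⁻¹ := ⟨_, rfl⟩
  obtain ⟨B, hB⟩ : ∃ B, B = 49 / (c^2/1024)^2 := ⟨_, rfl⟩
  have hcpos : 0 < c := by rw [hc]; positivity
  have hc2pos : 0 < c2 := by rw [hc2]; positivity
  have hBpos : 0 < B := by rw [hB]; positivity
  obtain ⟨D, hD⟩ : ∃ D, D = 32768 * lam + 128 / c2^2 + B := ⟨_, rfl⟩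
  have hDpos : 0 < D := by rw [hD]; positivity
  obtain ⟨s0, hs0⟩ : ∃ s0, s0 = 40 * L + 32 / c := ⟨_, rfl⟩
  have hs0pos : 0 < s0 := by rw [hs0]; positivity
  refine ⟨min (1 / (4 * D)) (1 / s0^2), max B s0, max D (s0^2), min c2 (1 / s0), max B (s0^2),
    by positivity, by positivity, by positivity, by positivity, by positivity, ?_⟩
  intro V _ dec G _
  obtain rfl : dec = (fun a b => Classical.propDecidable (a = b)) := Subsingleton.elim _ _
  intro hconn hT Ω hreg x hlt1 hlt2 hb pc hpc0 hpc1 hchi a₀ ha₀ htri ε hε p hp h0 h1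
  obtain ⟨s, hs⟩ : ∃ s : ℝ, s = (Fintype.card V : ℝ) ^ ((1:ℝ)/3) := ⟨_, rfl⟩
  have hcard : (1:ℝ) ≤ Fintype.card V := by
    have : 0 < Fintype.card V := Fintype.card_pos_iff.2 ⟨x⟩
    exact_mod_cast this
  have hs2 : (Fintype.card V : ℝ) ^ ((2:ℝ)/3) = s^2 := by
    rw [hs, ← Real.rpow_natCast, ← Real.rpow_mul (by linarith)]; norm_num
  have hs3 : (Fintype.card V : ℝ) = s^3 := by
    rw [hs, ← Real.rpow_natCast, ← Real.rpow_mul (by linarith)]; norm_num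
  have hs1 : 1 ≤ s := by rw [hs]; exact Real.one_le_rpow hcard (by norm_num)
  rw [hs2]
  rw [← hs] at hlt1 hlt2 hb hchi hε ⊢
  have hX : ∀ r, chi G x r = PW.X G x r := fun r => PW.expect_eq r _
  have key : PW.Concl G x p s (min (1 / (4 * D)) (1 / s0^2)) (max B s0) (max D (s0^2)) (min c2 (1 / s0))
      (max B (s0^2)) := by
    by_cases hsm : s ≤ s0
    · exact (PW.small h0 h1 x hs1 hsm hs3).mono (by linarith) (min_le_right _ _) (le_max_right _ _)
        (le_max_right _ _) (min_le_right _ _) (le_max_right _ _)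
    · push Not at hsm
      have hdeg : ∀ u, ∑ v, (if G.Adj u v then (1:ℝ) else 0) = Ω := by
        intro u
        rw [← hreg u, Finset.sum_boole, ← SimpleGraph.card_neighborFinset_eq_degree]
        congr 2
        ext v; simp
      have hΩ0 : (0:ℝ) < Ω := by
        have h1V : 1 < Fintype.card V := by
          have : (1:ℝ) < Fintype.card V := by linarith
          exact_mod_cast this
        have : Nontrivial V := Fintype.one_lt_card_iff_nontrivial.1 h1V
        have := hconn.preconnected.degree_pos_of_nontrivial x
        rw [hreg x] at this
        exact_mod_cast this
      have C : PW.Ctx G (Ω:ℝ) pc := by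
        refine ⟨hT, fun u => by rw [← hdeg u]; exact Finset.sum_congr rfl fun v _ => by congr, hΩ0, hpc0, hpc1, ?_⟩
        intro u v huv
        have h2 := htri u v
        rw [show kron u v = 0 from if_neg huv.ne] at h2
        simp only [triangle, PW.tau_eq] at h2
        linarith
      have hsL : 40 * L ≤ s := by
        have : 0 < 32 / c := by positivity
        linarith
      have hsc : 32 ≤ c * s := by
        have : 32 / c ≤ s := by linarith
        rw [div_le_iff₀ hcpos] at this; linarith
      have hpe : (Ω:ℝ) * |p - pc| ≤ L / s := by
        have : p - pc = (Ω:ℝ)⁻¹ * ε := by rw [hp]; ring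
        rw [this, abs_mul, abs_of_pos (inv_pos.2 hΩ0), ← mul_assoc, mul_inv_cancel₀ hΩ0.ne', one_mul]
        refine hε.trans ?_
        rw [div_eq_mul_inv]
        have : 0 ≤ s⁻¹ := by positivity
        gcongr
      have := C.large x hlam hL1 hs3 hsL (by rw [← hX]; exact hchi) (by norm_num at hb; linarith) hc hsc hc2 hB h0 h1 hpe
      rw [← hD] at this
      exact this.mono (by linarith) (min_le_left _ _) (le_max_left _ _)
        (le_max_left _ _) (min_le_left _ _) (le_max_left _ _)
  have e1 : expect G p (fun ω => (maxCluster G ω : ℝ)) = PW.Ex p (fun ω : G.edgeSet → Bool => (PW.Cm ω : ℝ)) :=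
    PW.expect_eq p _
  rw [e1, hX]
  refine ⟨⟨key.c4, key.c5⟩, ?_, key.c7, key.c8⟩
  intro w hw
  have e2 : prob G p (fun ω => w⁻¹ * s^2 ≤ (maxCluster G ω : ℝ) ∧ (maxCluster G ω : ℝ) ≤ w * s^2) =
      PW.Ex p (fun ω : G.edgeSet → Bool => PW.ind (w⁻¹ * s^2 ≤ (PW.Cm ω : ℝ) ∧ (PW.Cm ω : ℝ) ≤ w * s^2)) :=
    PW.prob_eq p _
  rw [e2]
  exact key.c6 w hw
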